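/- arXiv:1608.03197 — 8 statements merged into one kernel-verified Lean document; each statement's English description precedes it below -/
import Mathlib

section
/- Let n ≥ 1 and s ≥ 1, and let E_i (i = 1,…,n) be smooth functions of the jet variables (t, y₀, …, y_s), defined on all of ℝ × (ℝⁿ)^{s+1}. Then there exists a smooth Lagrange function L of (t, y₀, …, y_s), defined on all of ℝ × (ℝⁿ)^{s+1}, whose Euler–Poisson expressions coincide identically with the E_i (both regarded as functions of (t, y₀, …, y_{2s})) if and only if the following system of partial differential equations holds identically: (1) for all i, j: ∂E_i/∂y₀^j − ∂E_j/∂y₀^i + Σ_{k=0}^{s} (−1)^k D_t^k (∂E_i/∂y_k^j − ∂E_j/∂y_k^i) = 0; and (2) for every r with 1 ≤ r ≤ s and all i, j: ∂E_i/∂y_r^j − Σ_{k=r}^{s} (−1)^k (k!/((k−r)! r!)) D_t^{k−r} (∂E_j/∂y_k^i) = 0. -/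
noncomputable section

/-- Jet variables: time `t` together with rows `y₀, …, y_{N-1}` of `n` variables each. -/
abbrev Jet (n N : ℕ) : Type := ℝ × (Fin N → Fin n → ℝ)

/-- Coordinate access, out-of-range rows giving `0`. -/
def coord {n N : ℕ} (p : Jet n N) (r : ℕ) (i : Fin n) : ℝ :=
  if h : r < N then p.2 ⟨r, h⟩ i else 0

/-- Partial derivative in the time direction. -/
def pderT {n N : ℕ} (F : Jet n N → ℝ) (p : Jet n N) : ℝ :=
  fderiv ℝ F p (1, 0)

/-- Partial derivative in the `i`-th variable of the `r`-th row `y_r`. -/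
def pderY {n N : ℕ} (r : ℕ) (i : Fin n) (F : Jet n N → ℝ) : Jet n N → ℝ :=
  fun p => fderiv ℝ F p (0, fun r' => if (r' : ℕ) = r then Pi.single i 1 else 0)

/-- The total (formal time) derivative `D_t F = ∂F/∂t + Σ_r Σ_i y_{r+1}^i ∂F/∂y_r^i`,
truncated at the top row. -/
def totD {n N : ℕ} (F : Jet n N → ℝ) : Jet n N → ℝ :=
  fun p => pderT F p + ∑ r ∈ Finset.range N, ∑ i : Fin n, coord p (r + 1) i * pderY r i F p

/-- Extension of a function of a lower-order jet to a higher-order jet space. -/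
def extJ {n : ℕ} {N M : ℕ} (h : N ≤ M) (F : Jet n N → ℝ) : Jet n M → ℝ :=
  fun p => F (p.1, fun r => p.2 (Fin.castLE h r))

/-- Truncation of a jet to lower order. -/
def trJ {n : ℕ} {M : ℕ} (N : ℕ) (h : N ≤ M) (p : Jet n M) : Jet n N :=
  (p.1, fun r => p.2 (Fin.castLE h r))

theorem sum_neg_one_pow_mul_choose_mul_choose_add (r m c : ℕ) :
    ∑ a ∈ Finset.range (m + 1), (-1 : ℝ) ^ a * m.choose a * (c + a).choose r =
      if m ≤ r then (-1) ^ m * (c.choose (r - m) : ℝ) else 0 := by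
  have h := fwdDiff_iter_eq_sum_shift (1 : ℕ) (fun x : ℕ => (x.choose r : ℤ)) m c
  have h2 : (fwdDiff (1 : ℕ))^[m] (fun x : ℕ => (x.choose r : ℤ)) =
      if m ≤ r then fun x => (x.choose (r - m) : ℤ) else (0 : ℕ → ℤ) := by
    split_ifs with hm
    · obtain ⟨k, rfl⟩ := Nat.exists_eq_add_of_le hm
      simpa using fwdDiff_iter_choose k m
    · obtain ⟨k, rfl⟩ := Nat.exists_eq_add_of_lt (not_le.mp hm)
      rw [show r + k + 1 = (k + 1) + r by ring, Function.iterate_add_apply]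
      have h3 := fwdDiff_iter_choose 0 r
      simp only [add_zero, Nat.choose_zero_right, Nat.cast_one] at h3
      rw [h3, Function.iterate_succ_apply]
      have h0 : ∀ l : ℕ, (fwdDiff (1 : ℕ))^[l] (0 : ℕ → ℤ) = 0 := by
        intro l
        induction l with
        | zero => rfl
        | succ l ih => rw [Function.iterate_succ_apply', ih]; ext; simp [fwdDiff]
      rw [← h0 k]
      congr 1
  rw [h2] at h
  have h3 : ∑ a ∈ Finset.range (m + 1), (-1 : ℤ) ^ a * m.choose a * (c + a).choose r =
      if m ≤ r then (-1) ^ m * (c.choose (r - m) : ℤ) else 0 := by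
    have h4 : (if m ≤ r then (-1) ^ m * (c.choose (r - m) : ℤ) else 0) =
        (-1) ^ m * ((if m ≤ r then fun x : ℕ => (x.choose (r - m) : ℤ) else (0 : ℕ → ℤ)) c) := by
      split_ifs <;> simp
    rw [h4, h, Finset.mul_sum]
    refine Finset.sum_congr rfl fun a ha => ?_
    have : a ≤ m := Nat.lt_succ_iff.mp (Finset.mem_range.mp ha)
    obtain ⟨b, rfl⟩ := Nat.exists_eq_add_of_le this
    have h5 : (-1 : ℤ) ^ b * (-1) ^ b = 1 := by rw [← mul_pow]; simp
    simp only [Nat.add_sub_cancel_left, smul_eq_mul, mul_one, pow_add]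
    linear_combination (-((-1 : ℤ) ^ a * (a + b).choose a * (c + a).choose r)) * h5
  exact_mod_cast congrArg (Int.cast : ℤ → ℝ) h3


section HelmholtzOperators

open Finset Module

/-- Leibniz rule for iterates when `D` shifts a sequence of operators acting on the right. -/
theorem pow_mul_eq_sum_choose_of_mul_eq {A : Type*} [Ring A] (D : A) (Y : ℕ → A)
    (h : ∀ a, D * Y a = Y a * D + Y (a + 1)) (m : ℕ) :
    D ^ m * Y 0 = ∑ ij ∈ antidiagonal m, m.choose ij.1 • (Y ij.1 * D ^ ij.2) := by
  induction m with
  | zero => simp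
  | succ m ih =>
    rw [sum_antidiagonal_choose_succ_nsmul (fun i j => Y i * D ^ j) m, pow_succ', mul_assoc, ih,
      mul_sum, ← sum_add_distrib]
    refine sum_congr rfl fun ij hij => ?_
    have hc : m.choose ij.2 = m.choose ij.1 := by
      rw [← mem_antidiagonal.mp hij, Nat.choose_symm_add]
    rw [hc, mul_smul_comm, ← mul_assoc, h, add_mul, smul_add, pow_succ', mul_assoc]

/-- Leibniz rule for iterates when `D` shifts a sequence of operators acting on the left. -/
theorem mul_pow_eq_sum_choose_of_mul_eq {A : Type*} [Ring A] (D : A) (Q : ℕ → A)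
    (h : ∀ a, Q a * D = D * Q a + Q (a + 1)) (m : ℕ) :
    Q 0 * D ^ m = ∑ ij ∈ antidiagonal m, m.choose ij.1 • (D ^ ij.2 * Q ij.1) := by
  induction m with
  | zero => simp
  | succ m ih =>
    rw [sum_antidiagonal_choose_succ_nsmul (fun i j => D ^ j * Q i) m, pow_succ, ← mul_assoc, ih,
      sum_mul, ← sum_add_distrib]
    refine sum_congr rfl fun ij hij => ?_
    have hc : m.choose ij.2 = m.choose ij.1 := by
      rw [← mem_antidiagonal.mp hij, Nat.choose_symm_add]
    rw [hc, smul_mul_assoc, mul_assoc, h, mul_add, smul_add, pow_succ, mul_assoc]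

section HelmholtzAlgebra

variable {ι V : Type*} [AddCommGroup V] [Module ℝ V]

theorem mul_pow_eq_sum_range_choose {D : End ℝ V} {P : ℕ → End ℝ V} {M : ℕ}
    (h0 : P 0 * D = D * P 0) (hP : ∀ k, k + 1 < M → P (k + 1) * D = D * P (k + 1) + P k)
    {k : ℕ} (hk : k < M) (m : ℕ) :
    P k * D ^ m = ∑ a ∈ range (m + 1),
      (m.choose a : ℝ) • (D ^ (m - a) * if a ≤ k then P (k - a) else 0) := by
  have := mul_pow_eq_sum_choose_of_mul_eq D (fun a => if a ≤ k then P (k - a) else 0) (by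
    intro a
    rcases lt_trichotomy a k with h | h | h
    · obtain ⟨b, rfl⟩ := Nat.exists_eq_add_of_lt h
      have e1 : a + b + 1 - a = b + 1 := by omega
      have e2 : a + b + 1 - (a + 1) = b := by omega
      simp only [h.le, Nat.succ_le_of_lt h, if_true, e1, e2]
      exact hP b (by omega)
    · subst h; simp [h0]
    · simp [h.not_ge, (Nat.lt_succ_of_lt h).not_ge]) m
  simp only [Nat.zero_le, if_true, Nat.sub_zero] at this
  rw [this, Nat.sum_antidiagonal_eq_sum_range_succ_mk]
  exact sum_congr rfl fun a _ => by rw [Nat.cast_smul_eq_nsmul]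

theorem sum_range_shift_eq {W : Type*} [AddCommMonoid W] {s a : ℕ} (ha : a ≤ s) (g : ℕ → ℕ → W)
    (hg : ∀ k c, s < c → g k c = 0) :
    ∑ k ∈ range (2 * s + 1), (if a ≤ k then g k (k - a) else 0) =
      ∑ c ∈ range (s + 1), g (c + a) c := by
  symm
  refine sum_of_injOn (fun c => c + a) (by simp) ?_ ?_ ?_
  · intro c hc; simp at hc ⊢; omega
  · intro k hk hk'
    split_ifs with h
    · refine hg _ _ ?_
      by_contra hc
      exact hk' ⟨k - a, by simp; omega, by simp; omega⟩
    · rfl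
  · intro c _; simp

/-- The Euler–Poisson expressions of a Lagrange function satisfy the Helmholtz conditions. -/
theorem helmholtz_of_euler {s : ℕ} {D : End ℝ V} {P : ℕ → ι → End ℝ V}
    (h0 : ∀ i, P 0 i * D = D * P 0 i)
    (hP : ∀ k i, k + 1 < 2 * s + 1 → P (k + 1) i * D = D * P (k + 1) i + P k i)
    (hcomm : ∀ k l i j, P k i * P l j = P l j * P k i)
    {L : V} (hL : ∀ k i, s < k → P k i L = 0) {E : ι → V}
    (hE : ∀ i, E i = ∑ r ∈ range (s + 1), (-1 : ℝ) ^ r • (D ^ r) (P r i L))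
    {r : ℕ} (hr : r ≤ s) (i j : ι) :
    P r j (E i) = ∑ k ∈ range (2 * s + 1),
      ((-1 : ℝ) ^ k * (k.choose r : ℝ)) • (D ^ (k - r)) (P k i (E j)) := by
  have key : ∀ k, k < 2 * s + 1 → ∀ i j, P k j (E i) = ∑ m ∈ range (s + 1),
      ∑ a ∈ range (m + 1), if a ≤ k then ((-1 : ℝ) ^ m * m.choose a) •
        (D ^ (m - a)) (P (k - a) j (P m i L)) else 0 := by
    intro k hk i j
    rw [hE, map_sum]
    refine sum_congr rfl fun m _ => ?_
    have := congrArg (fun T : End ℝ V => T (P m i L))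
      (mul_pow_eq_sum_range_choose (P := fun k => P k j) (h0 j) (fun k => hP k j) hk m)
    simp only [Module.End.mul_apply, LinearMap.sum_apply, LinearMap.smul_apply] at this
    rw [map_smul, this, smul_sum]
    refine sum_congr rfl fun a _ => ?_
    split_ifs <;> simp [mul_smul]
  have hLL : ∀ c m i j, s < c → P c i (P m j L) = 0 := by
    intro c m i j hc
    have := congrArg (fun T : End ℝ V => T L) (hcomm c m i j)
    simp only [Module.End.mul_apply] at this
    rw [this, hL c i hc, map_zero]
  trans ∑ m ∈ range (s + 1), ∑ c ∈ range (s + 1), if c ≤ r then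
      ((-1 : ℝ) ^ m * m.choose (r - c)) • (D ^ (m - (r - c))) (P c j (P m i L)) else 0
  · rw [key r (by omega)]
    refine sum_congr rfl fun m _ => ?_
    trans ∑ a ∈ range (r + 1), ((-1 : ℝ) ^ m * m.choose a) •
        (D ^ (m - a)) (P (r - a) j (P m i L))
    · rw [← sum_filter]
      refine sum_subset (fun a ha => ?_) (fun a ha ha' => ?_)
      · simp at ha ⊢; omega
      · rw [Nat.choose_eq_zero_of_lt (by simp at ha ha'; omega)]; simp
    · rw [← sum_range_reflect, ← sum_filter,
        show (range (s + 1)).filter (· ≤ r) = range (r + 1) by ext; simp; omega]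
      refine sum_congr rfl fun c hc => ?_
      simp only [mem_range] at hc
      rw [show r + 1 - 1 - c = r - c by omega, show r - (r - c) = c by omega]
  · have e1 : ∀ k ∈ range (2 * s + 1), ((-1 : ℝ) ^ k * (k.choose r : ℝ)) •
        (D ^ (k - r)) (P k i (E j)) = ∑ m ∈ range (s + 1), ∑ a ∈ range (m + 1),
          if a ≤ k then ((-1 : ℝ) ^ k * (k.choose r) * ((-1 : ℝ) ^ m * m.choose a)) •
            (D ^ (k - r)) ((D ^ (m - a)) (P (k - a) i (P m j L))) else 0 := by
      intro k hk
      rw [key k (by simpa using hk), map_sum, smul_sum]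
      refine sum_congr rfl fun m _ => ?_
      rw [map_sum, smul_sum]
      refine sum_congr rfl fun a _ => ?_
      split_ifs <;> simp [mul_smul]
    rw [sum_congr rfl e1, sum_comm (s := range (2 * s + 1))]
    have e2 : ∀ m ∈ range (s + 1), ∑ k ∈ range (2 * s + 1), ∑ a ∈ range (m + 1),
          (if a ≤ k then ((-1 : ℝ) ^ k * (k.choose r) * ((-1 : ℝ) ^ m * m.choose a)) •
            (D ^ (k - r)) ((D ^ (m - a)) (P (k - a) i (P m j L))) else 0) =
        ∑ c ∈ range (s + 1), if m ≤ r then ((-1 : ℝ) ^ c * c.choose (r - m)) •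
          (D ^ (c - (r - m))) (P m j (P c i L)) else 0 := by
      intro m hm
      rw [sum_comm]
      have e3 : ∀ a ∈ range (m + 1), ∑ k ∈ range (2 * s + 1),
          (if a ≤ k then ((-1 : ℝ) ^ k * (k.choose r) * ((-1 : ℝ) ^ m * m.choose a)) •
            (D ^ (k - r)) ((D ^ (m - a)) (P (k - a) i (P m j L))) else 0) =
          ∑ c ∈ range (s + 1), ((-1 : ℝ) ^ c * (-1) ^ m *
            ((-1 : ℝ) ^ a * m.choose a * (c + a).choose r)) •
            (D ^ (c + m - r)) (P c i (P m j L)) := by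
        intro a ha
        simp only [mem_range] at ha hm
        rw [sum_range_shift_eq (by omega) (fun k c =>
          ((-1 : ℝ) ^ k * (k.choose r) * ((-1 : ℝ) ^ m * m.choose a)) •
            (D ^ (k - r)) ((D ^ (m - a)) (P c i (P m j L))))
          (fun k c hc => by simp [hLL c m i j hc])]
        refine sum_congr rfl fun c _ => ?_
        rcases lt_or_ge (c + a) r with h | h
        · simp [Nat.choose_eq_zero_of_lt h]
        · rw [← Module.End.mul_apply, ← pow_add,
            show c + a - r + (m - a) = c + m - r by omega]
          congr 1
          ring
      rw [sum_congr rfl e3, sum_comm]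
      refine sum_congr rfl fun c _ => ?_
      rw [← sum_smul, ← mul_sum, sum_neg_one_pow_mul_choose_mul_choose_add]
      split_ifs with h
      · rcases lt_or_ge c (r - m) with h' | h'
        · simp [Nat.choose_eq_zero_of_lt h']
        · have := congrArg (fun T : End ℝ V => T L) (hcomm c m i j)
          simp only [Module.End.mul_apply] at this
          rw [this, show c + m - r = c - (r - m) by omega]
          congr 1
          have h5 : (-1 : ℝ) ^ m * (-1) ^ m = 1 := by rw [← mul_pow]; simp
          linear_combination ((-1 : ℝ) ^ c * c.choose (r - m)) * h5
      · simp
    rw [sum_congr rfl e2, sum_comm]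

/-- If the positive-order part of an operator is formally self-adjoint, then the order-zero
defect of self-adjointness is skew. -/
theorem adjoint_defect_skew {s : ℕ} {D : End ℝ V} {p q : ℕ → V}
    (hp : ∀ r, 1 ≤ r → r ≤ s → p r = ∑ k ∈ Icc r s,
      ((-1 : ℝ) ^ k * (k.choose r : ℝ)) • (D ^ (k - r)) (q k)) :
    (p 0 - ∑ k ∈ range (s + 1), (-1 : ℝ) ^ k • (D ^ k) (q k)) +
      (q 0 - ∑ k ∈ range (s + 1), (-1 : ℝ) ^ k • (D ^ k) (p k)) = 0 := by
  have h1 : ∑ k ∈ Icc 1 s, (-1 : ℝ) ^ k • (D ^ k) (p k) =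
      ∑ k ∈ Icc 1 s, ∑ r ∈ Icc 1 k, ((-1 : ℝ) ^ r * k.choose r) •
        ((-1 : ℝ) ^ k • (D ^ k) (q k)) := by
    trans ∑ r ∈ Icc 1 s, ∑ k ∈ Icc r s, ((-1 : ℝ) ^ r * k.choose r) •
        ((-1 : ℝ) ^ k • (D ^ k) (q k))
    · refine sum_congr rfl fun r hr => ?_
      simp only [mem_Icc] at hr
      rw [hp r hr.1 hr.2, map_sum, smul_sum]
      refine sum_congr rfl fun k hk => ?_
      simp only [mem_Icc] at hk
      rw [map_smul, ← Module.End.mul_apply, ← pow_add, show r + (k - r) = k by omega,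
        smul_smul, smul_smul]
      congr 1
      ring
    · refine sum_comm' fun r k => ?_
      simp only [mem_Icc]
      omega
  have h2 : ∀ k ∈ Icc 1 s, ∑ r ∈ Icc 1 k, ((-1 : ℝ) ^ r * k.choose r) •
        ((-1 : ℝ) ^ k • (D ^ k) (q k)) = -((-1 : ℝ) ^ k • (D ^ k) (q k)) := by
    intro k hk
    simp only [mem_Icc] at hk
    have h3 := Int.alternating_sum_range_choose_of_ne (n := k) (by omega)
    rw [range_eq_Ico, sum_eq_sum_Ico_succ_bot (by omega)] at h3
    rw [← sum_smul]
    have h4 : ∑ r ∈ Icc 1 k, ((-1 : ℝ) ^ r * k.choose r) = -1 := by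
      have : ∑ r ∈ Icc 1 k, ((-1 : ℤ) ^ r * k.choose r) = -1 := by
        have e : Icc 1 k = Ico (0 + 1) (k + 1) := by ext; simp
        rw [e]
        simp only [pow_zero, Nat.choose_zero_right, Nat.cast_one, mul_one] at h3
        linarith
      exact_mod_cast congrArg (Int.cast : ℤ → ℝ) this
    rw [h4, neg_one_smul]
  rw [sum_congr rfl h2, sum_neg_distrib] at h1
  have e : ∀ f : ℕ → V, ∑ k ∈ range (s + 1), f k = f 0 + ∑ k ∈ Icc 1 s, f k := by
    intro f
    have : Icc 1 s = Ico (0 + 1) (s + 1) := by ext; simp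
    rw [this, range_eq_Ico, sum_eq_sum_Ico_succ_bot (by omega)]
  rw [e, e, h1]
  simp only [pow_zero, one_smul, Module.End.one_apply]
  abel

/-- The Vainberg–Tonti Lagrange function of a system satisfying the Helmholtz conditions. -/
theorem euler_of_helmholtz {s : ℕ} [Fintype ι] [DecidableEq ι]
    {D K₀ K₁ : End ℝ V} {P Y : ℕ → ι → End ℝ V}
    (hDY : ∀ a i, D * Y a i = Y a i * D + Y (a + 1) i)
    (hPY : ∀ k i j, P k i * Y 0 j = Y 0 j * P k i + if k = 0 ∧ i = j then 1 else 0)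
    (hDK : D * K₁ = K₁ * D) (hPK : ∀ k i, P k i * K₀ = K₁ * P k i)
    {E : ι → V}
    (hK : ∀ i, K₀ (E i) + ∑ a ∈ range (s + 1), ∑ j, Y a j (K₁ (P a j (E i))) = E i)
    (hE : ∀ r, r ≤ s → ∀ i j, P r j (E i) = ∑ k ∈ Icc r s,
      ((-1 : ℝ) ^ k * (k.choose r : ℝ)) • (D ^ (k - r)) (P k i (E j))) (i : ι) :
    E i = ∑ r ∈ range (s + 1), (-1 : ℝ) ^ r • (D ^ r) (P r i (∑ j, Y 0 j (K₀ (E j)))) := by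
  have h1 : ∀ r, P r i (∑ j, Y 0 j (K₀ (E j))) =
      (if r = 0 then K₀ (E i) else 0) + ∑ j, Y 0 j (K₁ (P r i (E j))) := by
    intro r
    rw [map_sum]
    have : ∀ j, P r i (Y 0 j (K₀ (E j))) =
        (if i = j then (if r = 0 then K₀ (E i) else 0) else 0) + Y 0 j (K₁ (P r i (E j))) := by
      intro j
      rw [← Module.End.mul_apply (P r i), hPY, LinearMap.add_apply, Module.End.mul_apply,
        ← Module.End.mul_apply (P r i) K₀, hPK, add_comm, Module.End.mul_apply]
      congr 1
      by_cases hij : i = j <;> by_cases hr : r = 0 <;> simp [hij, hr]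
    rw [sum_congr rfl fun j _ => this j, sum_add_distrib]
    simp
  have hDK' : ∀ b, D ^ b * K₁ = K₁ * D ^ b := fun b => (Commute.pow_left hDK b)
  have h2 : ∀ r ∈ range (s + 1), (-1 : ℝ) ^ r • (D ^ r) (P r i (∑ j, Y 0 j (K₀ (E j)))) =
      (if r = 0 then K₀ (E i) else 0) + ∑ j, ∑ a ∈ range (r + 1), Y a j (K₁
        (((-1 : ℝ) ^ r * r.choose a) • (D ^ (r - a)) (P r i (E j)))) := by
    intro r _
    rw [h1, map_add, smul_add, map_sum, smul_sum]
    congr 1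
    · by_cases hr : r = 0 <;> simp [hr]
    · refine sum_congr rfl fun j _ => ?_
      rw [← Module.End.mul_apply, pow_mul_eq_sum_choose_of_mul_eq D (fun a => Y a j)
        (fun a => hDY a j), Nat.sum_antidiagonal_eq_sum_range_succ_mk, LinearMap.sum_apply,
        smul_sum]
      refine sum_congr rfl fun a _ => ?_
      have := congrArg (fun T : End ℝ V => T (P r i (E j))) (hDK' (r - a))
      simp only [Module.End.mul_apply] at this
      rw [← Nat.cast_smul_eq_nsmul ℝ, LinearMap.smul_apply, Module.End.mul_apply, this]
      simp [mul_smul]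
  have h3 : ∑ r ∈ range (s + 1), ∑ j, ∑ a ∈ range (r + 1), Y a j (K₁
        (((-1 : ℝ) ^ r * r.choose a) • (D ^ (r - a)) (P r i (E j)))) =
      ∑ a ∈ range (s + 1), ∑ j, Y a j (K₁ (P a j (E i))) := by
    rw [sum_comm, sum_comm (s := range (s + 1))]
    refine sum_congr rfl fun j _ => ?_
    rw [sum_comm' (t' := range (s + 1)) (s' := fun a => Icc a s)
      (by intro r a; simp only [mem_range, mem_Icc]; omega)]
    refine sum_congr rfl fun a ha => ?_
    rw [hE a (by simpa [Nat.lt_succ_iff] using ha) i j, map_sum, map_sum]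
  rw [sum_congr rfl h2, sum_add_distrib, h3]
  simpa using (hK i).symm

end HelmholtzAlgebra

end HelmholtzOperators

section ParametricIntegral

open MeasureTheory

universe u

theorem hasFDerivAt_intervalIntegral_of_contDiff {X W : Type u} [NormedAddCommGroup X]
    [NormedSpace ℝ X] [ProperSpace X] [NormedAddCommGroup W] [NormedSpace ℝ W] [CompleteSpace W]
    {G : ℝ × X → W} (hG : ContDiff ℝ 1 G) (x : X) :
    HasFDerivAt (fun x => ∫ τ in (0 : ℝ)..1, G (τ, x))
      (∫ τ in (0 : ℝ)..1, (fderiv ℝ G (τ, x)).comp (ContinuousLinearMap.inr ℝ ℝ X)) x := by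
  have hc : Continuous fun q : ℝ × X => (fderiv ℝ G q).comp (ContinuousLinearMap.inr ℝ ℝ X) :=
    (hG.continuous_fderiv one_ne_zero).clm_comp continuous_const
  obtain ⟨C, hC⟩ := ((isCompact_Icc (a := (0 : ℝ)) (b := 1)).prod
    (isCompact_closedBall x 1)).exists_bound_of_continuousOn hc.continuousOn
  refine intervalIntegral.hasFDerivAt_integral_of_dominated_of_fderiv_le (bound := fun _ => C)
    (s := Metric.closedBall x 1)
    (F' := fun x τ => (fderiv ℝ G (τ, x)).comp (ContinuousLinearMap.inr ℝ ℝ X))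
    (Metric.closedBall_mem_nhds x one_pos)
    (.of_forall fun y => ?_) ?_ ?_ ?_ ?_ ?_
  · exact (hG.continuous.comp (by fun_prop : Continuous fun τ : ℝ => (τ, y))).aestronglyMeasurable
  · exact (hG.continuous.comp
      (by fun_prop : Continuous fun τ : ℝ => (τ, x))).intervalIntegrable _ _
  · exact (hc.comp (by fun_prop : Continuous fun τ : ℝ => (τ, x))).aestronglyMeasurable
  · refine .of_forall fun τ hτ y hy => hC (τ, y) ⟨?_, hy⟩
    rw [Set.uIoc_of_le zero_le_one] at hτ
    exact Set.Ioc_subset_Icc_self hτ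
  · simp
  · refine .of_forall fun τ _ y _ => ?_
    exact ((hG.differentiable one_ne_zero) (τ, y)).hasFDerivAt.comp y (hasFDerivAt_prodMk_right τ y)

theorem contDiff_intervalIntegral_of_contDiff {X W : Type u} [NormedAddCommGroup X]
    [NormedSpace ℝ X] [ProperSpace X] [NormedAddCommGroup W] [NormedSpace ℝ W] [CompleteSpace W]
    {G : ℝ × X → W} (hG : ContDiff ℝ (⊤ : ℕ∞) G) :
    ContDiff ℝ (⊤ : ℕ∞) fun x => ∫ τ in (0 : ℝ)..1, G (τ, x) := by
  rw [contDiff_infty]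
  intro m
  induction m generalizing W with
  | zero =>
    rw [Nat.cast_zero, contDiff_zero]
    exact intervalIntegral.continuous_parametric_intervalIntegral_of_continuous'
      (f := fun x τ => G (τ, x)) (hG.continuous.comp continuous_swap) 0 1
  | succ m ih =>
    have hd := hasFDerivAt_intervalIntegral_of_contDiff (hG.of_le (by exact_mod_cast le_top))
    rw [Nat.cast_succ, contDiff_succ_iff_fderiv]
    refine ⟨fun x => (hd x).differentiableAt, by simp, ?_⟩
    rw [show fderiv ℝ (fun x => ∫ τ in (0 : ℝ)..1, G (τ, x)) = _ from
      funext fun x => (hd x).fderiv]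
    exact ih (G := fun q => (fderiv ℝ G q).comp (ContinuousLinearMap.inr ℝ ℝ X))
      ((hG.fderiv_right (by simp)).clm_comp contDiff_const)

end ParametricIntegral

/-- Differentiating `F` along an affine vector field and then in a constant direction. -/
theorem fderiv_fderiv_affine {X : Type*} [NormedAddCommGroup X] [NormedSpace ℝ X]
    {F : X → ℝ} (hF : ContDiff ℝ (⊤ : ℕ∞) F) (A : X →L[ℝ] X) (c v p : X) :
    fderiv ℝ (fun q => fderiv ℝ F q (c + A q)) p v =
      fderiv ℝ (fun q => fderiv ℝ F q v) p (c + A p) + fderiv ℝ F p (A v) := by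
  have hd : DifferentiableAt ℝ (fderiv ℝ F) p :=
    (hF.fderiv_right (m := (⊤ : ℕ∞)) (by simp)).differentiable (by simp) p
  have h1 : HasFDerivAt (fun q => c + A q) A p := A.hasFDerivAt.const_add c
  have hs : IsSymmSndFDerivAt ℝ F p :=
    hF.contDiffAt.isSymmSndFDerivAt (by
      rw [minSmoothness_of_isRCLikeNormedField]
      exact WithTop.coe_le_coe.mpr (le_top : (2 : ℕ∞) ≤ ⊤))
  rw [(hd.hasFDerivAt.clm_apply h1).fderiv,
    (hd.hasFDerivAt.clm_apply (hasFDerivAt_const v p)).fderiv]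
  have := hs.eq v (c + A p)
  simp only [add_apply, ContinuousLinearMap.comp_apply,
    ContinuousLinearMap.flip_apply, zero_apply, map_zero]
  rw [this]
  ring

section JetCalculus

variable {n N M : ℕ}

/-- The unit vector of the coordinate `y_r^i`. -/
def rowVec (n M r : ℕ) (i : Fin n) : Jet n M :=
  (0, fun r' => if (r' : ℕ) = r then Pi.single i 1 else 0)

/-- The linear part of the vector field representing the total derivative. -/
def rowShift (n M : ℕ) : Jet n M →L[ℝ] Jet n M :=
  LinearMap.toContinuousLinearMap
    { toFun := fun p => (0, fun r i => coord p (r + 1) i)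
      map_add' := fun p q => by
        ext
        · simp
        · simp only [coord, Prod.snd_add, Pi.add_apply]; split_ifs <;> simp
      map_smul' := fun a p => by
        ext
        · simp
        · simp only [coord, Prod.smul_snd, Pi.smul_apply, RingHom.id_apply]; split_ifs <;> simp }

theorem rowShift_apply (p : Jet n M) :
    rowShift n M p = ((0, fun r i => coord p (r + 1) i) : Jet n M) := rfl

/-- The coordinate `y_r^i` as a linear function. -/
def coordL (n M r : ℕ) (i : Fin n) : Jet n M →L[ℝ] ℝ :=
  LinearMap.toContinuousLinearMap
    { toFun := fun p => coord p r i
      map_add' := fun p q => by simp only [coord]; split_ifs <;> simp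
      map_smul' := fun a p => by simp only [coord]; split_ifs <;> simp }

theorem coordL_apply (r : ℕ) (i : Fin n) (p : Jet n M) : coordL n M r i p = coord p r i := rfl

theorem coordL_rowVec {k : ℕ} (hk : k < M) (r : ℕ) (i j : Fin n) :
    coordL n M r j (rowVec n M k i) = if k = r ∧ i = j then 1 else 0 := by
  simp only [coordL_apply, coord, rowVec]
  by_cases hr : r < M
  · by_cases h : r = k <;> by_cases hij : j = i <;>
      simp [hr, h, hij, eq_comm] <;> simp_all [eq_comm]
  · rw [dif_neg hr, if_neg]
    rintro ⟨rfl, -⟩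
    exact hr hk

theorem coordL_rowShift (r : ℕ) (i : Fin n) (p : Jet n M) :
    coordL n M r i (rowShift n M p) = coordL n M (r + 1) i p := by
  simp only [coordL_apply, rowShift_apply, coord]
  split_ifs <;> first | rfl | omega

theorem rowShift_rowVec_zero (i : Fin n) : rowShift n M (rowVec n M 0 i) = 0 := by
  ext
  · rfl
  · simp [rowShift_apply, coord, rowVec]

theorem rowShift_rowVec_succ {k : ℕ} (hk : k + 1 < M) (i : Fin n) :
    rowShift n M (rowVec n M (k + 1) i) = rowVec n M k i := by
  ext r j
  · rfl
  · simp only [rowShift_apply, coord, rowVec]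
    split_ifs <;> first | rfl | omega

theorem mk_zero_eq_sum_rowVec (y : Fin M → Fin n → ℝ) :
    ((0, y) : Jet n M) =
      ∑ r ∈ Finset.range M, ∑ i, coord ((0, y) : Jet n M) r i • rowVec n M r i := by
  rw [Finset.sum_range]
  ext r j
  · simp [Prod.fst_sum, rowVec]
  · simp only [Prod.snd_sum, Finset.sum_apply, rowVec, Prod.smul_snd, Pi.smul_apply, coord,
      Fin.is_lt, dif_pos]
    rw [Finset.sum_eq_single r, Finset.sum_eq_single j] <;> simp +contextual [Pi.single_apply]
    intro b hb
    simp [Fin.val_inj, Ne.symm hb]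

theorem fderiv_mk_zero (F : Jet n M → ℝ) (p : Jet n M) (y : Fin M → Fin n → ℝ) :
    fderiv ℝ F p (0, y) =
      ∑ r ∈ Finset.range M, ∑ i, coord ((0, y) : Jet n M) r i * pderY r i F p := by
  conv_lhs => rw [mk_zero_eq_sum_rowVec y]
  simp only [map_sum, map_smul, smul_eq_mul]
  rfl

theorem totD_eq_fderiv (F : Jet n M → ℝ) :
    totD F = fun p => fderiv ℝ F p ((1, 0) + rowShift n M p) := by
  ext p
  rw [map_add, rowShift_apply, fderiv_mk_zero, totD, pderT]
  congr 1
  refine Finset.sum_congr rfl fun r hr => Finset.sum_congr rfl fun i _ => ?_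
  simp only [Finset.mem_range] at hr
  simp [coord, hr]

theorem pderY_eq_fderiv (r : ℕ) (i : Fin n) (F : Jet n M → ℝ) :
    pderY r i F = fun p => fderiv ℝ F p (rowVec n M r i) := rfl

/-- The dilation `(t, y) ↦ (t, τ y)`. -/
def dilate (n M : ℕ) (τ : ℝ) : Jet n M →L[ℝ] Jet n M :=
  (ContinuousLinearMap.id ℝ ℝ).prodMap (τ • ContinuousLinearMap.id ℝ _)

theorem dilate_apply (τ : ℝ) (p : Jet n M) : dilate n M τ p = (p.1, τ • p.2) := rfl

theorem dilate_rowVec (τ : ℝ) (k : ℕ) (i : Fin n) :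
    dilate n M τ (rowVec n M k i) = τ • rowVec n M k i := by
  ext <;> simp [dilate_apply, rowVec]

theorem dilate_totD_field (τ : ℝ) (p : Jet n M) :
    dilate n M τ ((1, 0) + rowShift n M p) = (1, 0) + rowShift n M (dilate n M τ p) := by
  ext
  · simp [dilate_apply, rowShift_apply]
  · simp only [dilate_apply, rowShift_apply, coord]
    simp

/-- The weighted radial average `∫₀¹ τ^e F(t, τ y) dτ`. -/
def radialAvg (e : ℕ) (F : Jet n M → ℝ) (p : Jet n M) : ℝ :=
  ∫ τ in (0 : ℝ)..1, τ ^ e * F (dilate n M τ p)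

theorem contDiff_radialIntegrand (e : ℕ) {F : Jet n M → ℝ} (hF : ContDiff ℝ (⊤ : ℕ∞) F) :
    ContDiff ℝ (⊤ : ℕ∞) fun q : ℝ × Jet n M => q.1 ^ e * F (dilate n M q.1 q.2) := by
  simp only [dilate_apply]
  fun_prop

theorem contDiff_radialAvg (e : ℕ) {F : Jet n M → ℝ} (hF : ContDiff ℝ (⊤ : ℕ∞) F) :
    ContDiff ℝ (⊤ : ℕ∞) (radialAvg e F) :=
  contDiff_intervalIntegral_of_contDiff (contDiff_radialIntegrand e hF)

theorem intervalIntegrable_radial (e : ℕ) {F : Jet n M → ℝ} (hF : Continuous F) (p : Jet n M) :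
    IntervalIntegrable (fun τ : ℝ => τ ^ e * F (dilate n M τ p)) MeasureTheory.volume 0 1 := by
  simp only [dilate_apply]
  exact (by fun_prop : Continuous _).intervalIntegrable _ _

theorem fderiv_radialAvg (e : ℕ) {F : Jet n M → ℝ} (hF : ContDiff ℝ (⊤ : ℕ∞) F) (p v : Jet n M) :
    fderiv ℝ (radialAvg e F) p v =
      ∫ τ in (0 : ℝ)..1, τ ^ e * fderiv ℝ F (dilate n M τ p) (dilate n M τ v) := by
  have hG := (contDiff_radialIntegrand e hF).of_le (m := 1) (by exact_mod_cast le_top)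
  have h := (hasFDerivAt_intervalIntegral_of_contDiff hG p).fderiv
  change fderiv ℝ (radialAvg e F) p = _ at h
  have hc : Continuous fun τ : ℝ => (fderiv ℝ (fun q : ℝ × Jet n M =>
      q.1 ^ e * F (dilate n M q.1 q.2)) (τ, p)).comp (ContinuousLinearMap.inr ℝ ℝ (Jet n M)) :=
    ((hG.continuous_fderiv one_ne_zero).comp
      (by fun_prop : Continuous fun τ : ℝ => (τ, p))).clm_comp continuous_const
  rw [h, ContinuousLinearMap.intervalIntegral_apply (hc.intervalIntegrable _ _)]
  refine intervalIntegral.integral_congr fun τ _ => ?_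
  have h1 := (hG.differentiable one_ne_zero (τ, p)).hasFDerivAt.comp p
    (hasFDerivAt_prodMk_right τ p)
  have h2 : HasFDerivAt (fun q => τ ^ e * F (dilate n M τ q))
      (τ ^ e • (fderiv ℝ F (dilate n M τ p)).comp (dilate n M τ)) p :=
    (((hF.differentiable (by simp)) _).hasFDerivAt.comp p
      (dilate n M τ).hasFDerivAt).const_mul (τ ^ e)
  have h3 := congrArg (fun T : Jet n M →L[ℝ] ℝ => T v) (h1.unique h2)
  simpa using h3

theorem radialAvg_zero_add_sum {F : Jet n M → ℝ} (hF : ContDiff ℝ (⊤ : ℕ∞) F) (p : Jet n M) :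
    radialAvg 0 F p + ∑ r ∈ Finset.range M, ∑ i, coord p r i * radialAvg 1 (pderY r i F) p =
      F p := by
  have hcY : ∀ r i, Continuous (pderY r i F) := fun r i =>
    (hF.continuous_fderiv (by simp)).clm_apply continuous_const
  have hderiv : ∀ τ : ℝ, HasDerivAt (fun τ => τ * F (dilate n M τ p))
      (τ ^ 0 * F (dilate n M τ p) + ∑ r ∈ Finset.range M, ∑ i,
        coord p r i * (τ ^ 1 * pderY r i F (dilate n M τ p))) τ := by
    intro τ
    have h1 : HasDerivAt (fun τ => dilate n M τ p) (0, p.2) τ := by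
      simp only [dilate_apply]
      exact (hasDerivAt_const τ p.1).prodMk (by simpa using (hasDerivAt_id τ).smul_const p.2)
    have h2 := (hasDerivAt_id τ).mul
      (((hF.differentiable (by simp)) (dilate n M τ p)).hasFDerivAt.comp_hasDerivAt τ h1)
    refine h2.congr_deriv ?_
    rw [fderiv_mk_zero, Finset.mul_sum]
    simp only [Finset.mul_sum]
    simp only [id, one_mul, pow_zero, pow_one, Function.comp]
    congr 1
    refine Finset.sum_congr rfl fun r _ => Finset.sum_congr rfl fun i _ => ?_
    simp only [coord]
    ring
  have hi : ∀ r i, IntervalIntegrable (fun τ : ℝ =>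
      coord p r i * (τ ^ 1 * pderY r i F (dilate n M τ p))) MeasureTheory.volume 0 1 :=
    fun r i => (intervalIntegrable_radial 1 (hcY r i) p).const_mul _
  have hi' : ∀ r ∈ Finset.range M, IntervalIntegrable (fun τ : ℝ => ∑ i,
      coord p r i * (τ ^ 1 * pderY r i F (dilate n M τ p))) MeasureTheory.volume 0 1 :=
    fun r _ => by
      simpa only [Finset.sum_fn] using IntervalIntegrable.sum Finset.univ (fun i _ => hi r i)
  have hi'' : IntervalIntegrable (fun τ : ℝ => ∑ r ∈ Finset.range M, ∑ i,
      coord p r i * (τ ^ 1 * pderY r i F (dilate n M τ p))) MeasureTheory.volume 0 1 := by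
    simpa only [Finset.sum_fn] using IntervalIntegrable.sum (Finset.range M) hi'
  have hi0 := intervalIntegrable_radial 0 hF.continuous p
  have h := intervalIntegral.integral_eq_sub_of_hasDerivAt (fun τ _ => hderiv τ) (hi0.add hi'')
  rw [intervalIntegral.integral_add hi0 hi'', intervalIntegral.integral_finsetSum hi'] at h
  simp only [one_mul, zero_mul, sub_zero] at h
  rw [show dilate n M 1 p = p by ext <;> simp [dilate_apply]] at h
  rw [← h, radialAvg]
  congr 1
  refine Finset.sum_congr rfl fun r _ => ?_
  rw [intervalIntegral.integral_finsetSum fun i _ => hi r i]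
  exact Finset.sum_congr rfl fun i _ => (intervalIntegral.integral_const_mul _ _).symm

end JetCalculus

section Helmholtz

open Finset Module

section JetOperators

variable {n N M : ℕ}

/-- The space of smooth functions on a jet space. -/
def smoothJet (n M : ℕ) : Submodule ℝ (Jet n M → ℝ) where
  carrier := {F | ContDiff ℝ (⊤ : ℕ∞) F}
  add_mem' := fun {F G} (hF : ContDiff ℝ _ F) (hG : ContDiff ℝ _ G) =>
    show ContDiff ℝ (⊤ : ℕ∞) (F + G) from hF.add hG
  zero_mem' := show ContDiff ℝ (⊤ : ℕ∞) (fun _ => 0 : Jet n M → ℝ) from contDiff_const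
  smul_mem' := fun a F (hF : ContDiff ℝ _ F) =>
    show ContDiff ℝ (⊤ : ℕ∞) (a • F) from hF.const_smul a

theorem contDiff_coe (F : smoothJet n M) : ContDiff ℝ (⊤ : ℕ∞) (F : Jet n M → ℝ) := F.2

theorem differentiable_coe (F : smoothJet n M) : Differentiable ℝ (F : Jet n M → ℝ) :=
  (contDiff_coe F).differentiable (by simp)

/-- The derivative along the affine vector field `p ↦ c + A p`. -/
def fieldDer (c : Jet n M) (A : Jet n M →L[ℝ] Jet n M) : Module.End ℝ (smoothJet n M) where
  toFun F := ⟨fun p => fderiv ℝ F p (c + A p),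
    ((contDiff_coe F).fderiv_right (m := (⊤ : ℕ∞)) (by simp)).clm_apply (by fun_prop)⟩
  map_add' F G := by
    ext p
    change fderiv ℝ (F + G : Jet n M → ℝ) p _ = _
    rw [fderiv_add (differentiable_coe F p) (differentiable_coe G p)]
    rfl
  map_smul' a F := by
    ext p
    change fderiv ℝ (a • F : Jet n M → ℝ) p _ = _
    rw [fderiv_const_smul (differentiable_coe F p)]
    rfl

theorem fieldDer_apply (c : Jet n M) (A : Jet n M →L[ℝ] Jet n M) (F : smoothJet n M)
    (p : Jet n M) : (fieldDer c A F : Jet n M → ℝ) p = fderiv ℝ (F : Jet n M → ℝ) p (c + A p) := rfl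

theorem fieldDer_commutator (c v : Jet n M) (A : Jet n M →L[ℝ] Jet n M) :
    fieldDer v 0 * fieldDer c A = fieldDer c A * fieldDer v 0 + fieldDer (A v) 0 := by
  ext F p
  have h := fderiv_fderiv_affine (contDiff_coe F) A c v p
  simpa [fieldDer] using h

/-- The total derivative as an operator on smooth functions. -/
def totOp (n M : ℕ) : Module.End ℝ (smoothJet n M) := fieldDer (1, 0) (rowShift n M)

/-- The partial derivative in `y_r^i` as an operator on smooth functions. -/
def rowOp (n M r : ℕ) (i : Fin n) : Module.End ℝ (smoothJet n M) := fieldDer (rowVec n M r i) 0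

theorem coe_totOp_pow (k : ℕ) (F : smoothJet n M) :
    ((totOp n M ^ k) F : Jet n M → ℝ) = totD^[k] F := by
  induction k with
  | zero => rfl
  | succ k ih =>
    rw [pow_succ', Module.End.mul_apply, Function.iterate_succ_apply', ← ih, totD_eq_fderiv]
    rfl

theorem coe_rowOp (r : ℕ) (i : Fin n) (F : smoothJet n M) :
    (rowOp n M r i F : Jet n M → ℝ) = pderY r i F := by
  ext p
  simp [rowOp, fieldDer_apply, pderY_eq_fderiv]

theorem rowOp_zero_mul_totOp (i : Fin n) :
    rowOp n M 0 i * totOp n M = totOp n M * rowOp n M 0 i := by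
  rw [rowOp, totOp, fieldDer_commutator, rowShift_rowVec_zero]
  ext F p
  simp [fieldDer_apply]

theorem rowOp_succ_mul_totOp {k : ℕ} (hk : k + 1 < M) (i : Fin n) :
    rowOp n M (k + 1) i * totOp n M =
      totOp n M * rowOp n M (k + 1) i + rowOp n M k i := by
  rw [rowOp, totOp, fieldDer_commutator, rowShift_rowVec_succ hk, rowOp]

theorem rowOp_comm (k l : ℕ) (i j : Fin n) :
    rowOp n M k i * rowOp n M l j = rowOp n M l j * rowOp n M k i := by
  rw [rowOp, rowOp, fieldDer_commutator]
  ext F p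
  simp [fieldDer_apply]

/-- Multiplication by the coordinate `y_r^i`. -/
def coordOp (n M r : ℕ) (i : Fin n) : Module.End ℝ (smoothJet n M) where
  toFun F := ⟨fun p => coordL n M r i p * (F : Jet n M → ℝ) p,
    (coordL n M r i).contDiff.mul (contDiff_coe F)⟩
  map_add' F G := by ext p; exact mul_add _ _ _
  map_smul' a F := by ext p; exact mul_left_comm _ _ _

theorem coordOp_apply (r : ℕ) (i : Fin n) (F : smoothJet n M) (p : Jet n M) :
    (coordOp n M r i F : Jet n M → ℝ) p = coordL n M r i p * (F : Jet n M → ℝ) p := rfl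

theorem fieldDer_coordOp_apply (c : Jet n M) (A : Jet n M →L[ℝ] Jet n M) (r : ℕ) (i : Fin n)
    (F : smoothJet n M) (p : Jet n M) :
    (fieldDer c A (coordOp n M r i F) : Jet n M → ℝ) p =
      coordL n M r i p * fderiv ℝ F p (c + A p) + coordL n M r i (c + A p) * (F : Jet n M → ℝ) p := by
  rw [fieldDer_apply]
  have h := ((coordL n M r i).hasFDerivAt (x := p)).mul (differentiable_coe F p).hasFDerivAt
  change fderiv ℝ (⇑(coordL n M r i) * (F : Jet n M → ℝ)) p _ = _
  rw [h.fderiv]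
  simp [mul_comm]

theorem totOp_mul_coordOp (r : ℕ) (i : Fin n) :
    totOp n M * coordOp n M r i = coordOp n M r i * totOp n M + coordOp n M (r + 1) i := by
  ext F p
  have h : coordL n M r i ((1, 0) : Jet n M) = 0 := by simp [coordL_apply, coord]
  have := fieldDer_coordOp_apply (1, 0) (rowShift n M) r i F p
  rw [map_add (coordL n M r i), coordL_rowShift, h, zero_add] at this
  exact this

theorem rowOp_mul_coordOp (hM : 0 < M) (k : ℕ) (i j : Fin n) :
    rowOp n M k i * coordOp n M 0 j =
      coordOp n M 0 j * rowOp n M k i + if k = 0 ∧ i = j then 1 else 0 := by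
  have hv : coordL n M 0 j (rowVec n M k i) = if k = 0 ∧ i = j then 1 else 0 := by
    rcases lt_or_ge k M with hk | hk
    · exact coordL_rowVec hk 0 i j
    · rw [if_neg (by omega), coordL_apply, coord, dif_pos hM, rowVec]
      simp [show ¬ 0 = k by omega]
  ext F p
  have := fieldDer_coordOp_apply (rowVec n M k i) 0 0 j F p
  rw [zero_apply, add_zero, hv] at this
  refine this.trans ?_
  split_ifs with h <;> simp [coordOp_apply, rowOp, fieldDer_apply, h]

/-- The radial average as an operator on smooth functions. -/
def avgOp (n M e : ℕ) : Module.End ℝ (smoothJet n M) where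
  toFun F := ⟨radialAvg e F, contDiff_radialAvg e (contDiff_coe F)⟩
  map_add' F G := by
    ext p
    change radialAvg e (F + G : Jet n M → ℝ) p = radialAvg e F p + radialAvg e G p
    simp only [radialAvg, Pi.add_apply, mul_add]
    exact intervalIntegral.integral_add (intervalIntegrable_radial e (contDiff_coe F).continuous p)
      (intervalIntegrable_radial e (contDiff_coe G).continuous p)
  map_smul' a F := by
    ext p
    change radialAvg e (a • F : Jet n M → ℝ) p = a * radialAvg e F p
    simp only [radialAvg, Pi.smul_apply, smul_eq_mul, mul_left_comm _ a]
    exact intervalIntegral.integral_const_mul _ _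

theorem totOp_mul_avgOp (e : ℕ) : totOp n M * avgOp n M e = avgOp n M e * totOp n M := by
  ext F p
  refine (fderiv_radialAvg e (contDiff_coe F) p _).trans ?_
  simp only [dilate_totD_field]
  rfl

theorem rowOp_mul_avgOp_zero (k : ℕ) (i : Fin n) :
    rowOp n M k i * avgOp n M 0 = avgOp n M 1 * rowOp n M k i := by
  ext F p
  refine (fderiv_radialAvg 0 (contDiff_coe F) p _).trans ?_
  change _ = radialAvg 1 (rowOp n M k i F : Jet n M → ℝ) p
  rw [coe_rowOp, radialAvg]
  simp [dilate_rowVec, pderY_eq_fderiv]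

theorem avgOp_zero_add_sum (F : smoothJet n M) :
    avgOp n M 0 F + ∑ r ∈ range M, ∑ i, coordOp n M r i (avgOp n M 1 (rowOp n M r i F)) = F := by
  ext p
  have h := radialAvg_zero_add_sum (contDiff_coe F) p
  simp only [← coe_rowOp] at h
  simp only [Submodule.coe_add, Submodule.coe_sum, Pi.add_apply, Finset.sum_apply]
  exact h

/-- Truncation of jets as a continuous linear map. -/
def truncL (h : N ≤ M) : Jet n M →L[ℝ] Jet n N :=
  (ContinuousLinearMap.id ℝ ℝ).prodMap
    (ContinuousLinearMap.pi fun r => ContinuousLinearMap.proj (Fin.castLE h r))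

/-- Extension of a smooth function to a higher-order jet space. -/
def extSmooth (h : N ≤ M) (F : Jet n N → ℝ) (hF : ContDiff ℝ (⊤ : ℕ∞) F) : smoothJet n M :=
  ⟨extJ h F, hF.comp (truncL h).contDiff⟩

theorem rowOp_extSmooth_eq_zero (h : N ≤ M) {F : Jet n N → ℝ} (hF : ContDiff ℝ (⊤ : ℕ∞) F)
    {k : ℕ} (hk : N ≤ k) (i : Fin n) : rowOp n M k i (extSmooth h F hF) = 0 := by
  ext p
  rw [coe_rowOp]
  change fderiv ℝ (F ∘ truncL h) p (rowVec n M k i) = 0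
  rw [fderiv_comp p (hF.differentiable (by simp) _) (truncL h).differentiableAt]
  have : truncL h (rowVec n M k i) = 0 := by
    ext r
    · rfl
    · change (if (r : ℕ) = k then Pi.single i 1 else 0 : Fin n → ℝ) _ = _
      rw [if_neg (by omega)]
      rfl
  simp [this]

end JetOperators

theorem sum_range_choose_eq_sum_Icc {W : Type*} [AddCommGroup W] [Module ℝ W] {r s m : ℕ}
    (hm : s < m) (c : ℕ → ℝ) (g : ℕ → W) (hg : ∀ k, s < k → k < m → g k = 0) :
    ∑ k ∈ range m, (c k * (k.choose r : ℝ)) • g k =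
      ∑ k ∈ Icc r s, (c k * (k.choose r : ℝ)) • g k := by
  symm
  refine sum_subset (fun k hk => ?_) fun k hk hk' => ?_
  · simp only [mem_Icc, mem_range] at *; omega
  · simp only [mem_Icc, mem_range, not_and, not_le] at *
    rcases lt_or_ge k r with h | h
    · simp [Nat.choose_eq_zero_of_lt h]
    · simp [hg k (hk' h) hk]

/-- A smooth system comes from a Lagrange function if and only if its linearization is formally
self-adjoint. -/
theorem exists_lagrange_iff_helmholtz {n s : ℕ} (hM : s + 1 ≤ 2 * s + 1)
    (E : Fin n → Jet n (s + 1) → ℝ) (hE : ∀ i, ContDiff ℝ (⊤ : ℕ∞) (E i)) :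
    (∃ (L : Jet n (s + 1) → ℝ) (hL : ContDiff ℝ (⊤ : ℕ∞) L), ∀ i,
      extSmooth hM (E i) (hE i) = ∑ r ∈ range (s + 1), (-1 : ℝ) ^ r •
        (totOp n (2 * s + 1) ^ r) (rowOp n _ r i (extSmooth hM L hL))) ↔
    ∀ r, r ≤ s → ∀ i j, rowOp n _ r j (extSmooth hM (E i) (hE i)) = ∑ k ∈ Icc r s,
      ((-1 : ℝ) ^ k * (k.choose r : ℝ)) •
        (totOp n (2 * s + 1) ^ (k - r)) (rowOp n _ k i (extSmooth hM (E j) (hE j))) := by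
  constructor
  · rintro ⟨L, hL, h⟩ r hr i j
    rw [helmholtz_of_euler rowOp_zero_mul_totOp (fun k i hk => rowOp_succ_mul_totOp hk i)
      rowOp_comm (fun k i hk => rowOp_extSmooth_eq_zero hM hL hk i) h hr i j]
    refine sum_range_choose_eq_sum_Icc (by omega) (fun k => (-1 : ℝ) ^ k)
      (fun k => (totOp n (2 * s + 1) ^ (k - r)) (rowOp n _ k i (extSmooth hM (E j) (hE j))))
      fun k hk _ => ?_
    rw [rowOp_extSmooth_eq_zero hM _ hk, map_zero]
  · intro h
    have hL : ContDiff ℝ (⊤ : ℕ∞) fun p : Jet n (s + 1) =>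
        ∑ j, coordL n (s + 1) 0 j p * radialAvg 0 (E j) p :=
      ContDiff.sum fun j _ => (coordL n (s + 1) 0 j).contDiff.mul (contDiff_radialAvg 0 (hE j))
    refine ⟨_, hL, fun i => ?_⟩
    have hext : extSmooth hM _ hL = ∑ j, coordOp n (2 * s + 1) 0 j
        (avgOp n (2 * s + 1) 0 (extSmooth hM (E j) (hE j))) := by
      ext p
      rw [Submodule.coe_sum, Finset.sum_apply]
      change ∑ j, coord (truncL hM p) 0 j * radialAvg 0 (E j) (truncL hM p) = _
      refine sum_congr rfl fun j _ => ?_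
      change _ = coord p 0 j * radialAvg 0 (E j) (truncL hM p)
      congr 1
    rw [hext]
    refine euler_of_helmholtz totOp_mul_coordOp (rowOp_mul_coordOp (by omega))
      (totOp_mul_avgOp 1) rowOp_mul_avgOp_zero (fun i => ?_) h i
    conv_rhs => rw [← avgOp_zero_add_sum (extSmooth hM (E i) (hE i))]
    congr 1
    refine sum_subset (by simpa using hM) fun a _ ha => sum_eq_zero fun j _ => ?_
    rw [rowOp_extSmooth_eq_zero hM _ (by simpa using ha), map_zero, map_zero]

theorem helmholtz_iff {n s : ℕ} {V : Type*} [AddCommGroup V] [Module ℝ V] (D : End ℝ V)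
    (p : ℕ → Fin n → Fin n → V) :
    (∀ r, r ≤ s → ∀ i j, p r i j = ∑ k ∈ Icc r s,
      ((-1 : ℝ) ^ k * (k.choose r : ℝ)) • (D ^ (k - r)) (p k j i)) ↔
    (∀ i j, p 0 i j - p 0 j i +
      ∑ k ∈ range (s + 1), (-1 : ℝ) ^ k • (D ^ k) (p k i j - p k j i) = 0) ∧
    ∀ r, 1 ≤ r → r ≤ s → ∀ i j, p r i j - ∑ k ∈ Icc r s,
      ((-1 : ℝ) ^ k * (k.choose r : ℝ)) • (D ^ (k - r)) (p k j i) = 0 := by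
  have hz : ∀ i j, ∑ k ∈ Icc 0 s, ((-1 : ℝ) ^ k * (k.choose 0 : ℝ)) •
      (D ^ (k - 0)) (p k j i) = ∑ k ∈ range (s + 1), (-1 : ℝ) ^ k • (D ^ k) (p k j i) := by
    intro i j
    rw [← Nat.range_succ_eq_Icc_zero]
    simp
  have hsplit : ∀ i j, p 0 i j - p 0 j i +
      ∑ k ∈ range (s + 1), (-1 : ℝ) ^ k • (D ^ k) (p k i j - p k j i) =
      (p 0 i j - ∑ k ∈ range (s + 1), (-1 : ℝ) ^ k • (D ^ k) (p k j i)) -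
      (p 0 j i - ∑ k ∈ range (s + 1), (-1 : ℝ) ^ k • (D ^ k) (p k i j)) := by
    intro i j
    simp only [map_sub, smul_sub, sum_sub_distrib]
    abel
  constructor
  · refine fun h => ⟨fun i j => ?_, fun r _ hr i j => sub_eq_zero.mpr (h r hr i j)⟩
    have h0 : ∀ i j, p 0 i j = ∑ k ∈ range (s + 1), (-1 : ℝ) ^ k • (D ^ k) (p k j i) :=
      fun i j => (h 0 (Nat.zero_le s) i j).trans (hz i j)
    rw [hsplit, sub_eq_zero.mpr (h0 i j), sub_eq_zero.mpr (h0 j i), sub_zero]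
  · rintro ⟨h1, h2⟩ r hr i j
    rcases Nat.eq_zero_or_pos r with rfl | hpos
    · rw [hz, ← sub_eq_zero]
      have hskew := adjoint_defect_skew (s := s) (D := D) (p := fun k => p k i j)
        (q := fun k => p k j i) fun r h hr => sub_eq_zero.mp (h2 r h hr i j)
      have hsym := h1 i j
      rw [hsplit, sub_eq_zero] at hsym
      rw [← hsym, ← two_smul ℝ] at hskew
      exact (smul_eq_zero.mp hskew).resolve_left two_ne_zero
    · exact sub_eq_zero.mp (h2 r hpos hr i j)

end Helmholtz

/-- generalized Helmholtz conditions.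
A system `E_i` of smooth functions of the jet variables `(t, y₀, …, y_s)` consists of the
Euler–Poisson expressions of some smooth Lagrange function `L(t, y₀, …, y_s)` (both sides
regarded as functions of `(t, y₀, …, y_{2s})`) if and only if the system of PDEs (1)–(2)
holds identically. -/
theorem statement_0 (n s : ℕ) (hn : 1 ≤ n) (hs : 1 ≤ s)
    (E : Fin n → (ℝ × (Fin (s + 1) → Fin n → ℝ)) → ℝ)
    (hE : ∀ i, ContDiff ℝ (⊤ : ℕ∞) (E i)) :
    (∃ L : (ℝ × (Fin (s + 1) → Fin n → ℝ)) → ℝ, ContDiff ℝ (⊤ : ℕ∞) L ∧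
      ∀ (i : Fin n) (p : Jet n (2 * s + 1)),
        extJ (n := n) (by omega) (E i) p =
          ∑ r ∈ Finset.range (s + 1),
            (-1 : ℝ) ^ r * totD^[r] (pderY r i (extJ (n := n) (by omega) L)) p) ↔
    ((∀ (i j : Fin n) (p : Jet n (2 * s + 1)),
        pderY 0 j (extJ (n := n) (by omega) (E i)) p
          - pderY 0 i (extJ (n := n) (by omega) (E j)) p
          + ∑ k ∈ Finset.range (s + 1), (-1 : ℝ) ^ k *
              totD^[k] (fun q => pderY k j (extJ (n := n) (by omega) (E i)) q
                - pderY k i (extJ (n := n) (by omega) (E j)) q) p = 0)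
      ∧ (∀ r : ℕ, 1 ≤ r → r ≤ s → ∀ (i j : Fin n) (p : Jet n (2 * s + 1)),
          pderY r j (extJ (n := n) (by omega) (E i)) p
            - ∑ k ∈ Finset.Icc r s, (-1 : ℝ) ^ k * (k.choose r : ℝ) *
                totD^[k - r] (pderY k i (extJ (n := n) (by omega) (E j))) p = 0)) := by
  have hM : s + 1 ≤ 2 * s + 1 := by omega
  have hsmooth := (exists_lagrange_iff_helmholtz hM E hE).trans
    (helmholtz_iff (totOp n (2 * s + 1)) fun k i j => rowOp n _ k j (extSmooth hM (E i) (hE i)))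
  have hcoe : ∀ (k : ℕ) (i : Fin n) (F : Jet n (s + 1) → ℝ) (hF : ContDiff ℝ (⊤ : ℕ∞) F),
      (rowOp n (2 * s + 1) k i (extSmooth hM F hF) : Jet n (2 * s + 1) → ℝ) =
        pderY k i (extJ hM F) := fun k i F hF => coe_rowOp k i _
  convert hsmooth using 1
  · refine exists_congr fun L => ?_
    rw [← exists_prop]
    refine exists_congr fun hL => forall_congr' fun i => ?_
    rw [Subtype.ext_iff, funext_iff]
    refine forall_congr' fun p => ?_
    rw [Submodule.coe_sum, Finset.sum_apply]
    simp only [Submodule.coe_smul, Pi.smul_apply, smul_eq_mul, coe_totOp_pow, hcoe]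
    rfl
  · refine and_congr (forall_congr' fun i => forall_congr' fun j => ?_)
      (forall_congr' fun r => forall_congr' fun _ => forall_congr' fun _ =>
        forall_congr' fun i => forall_congr' fun j => ?_)
    · rw [Subtype.ext_iff, funext_iff]
      refine forall_congr' fun p => ?_
      rw [Submodule.coe_add, Pi.add_apply, Submodule.coe_sum, Finset.sum_apply]
      simp only [Submodule.coe_smul, Pi.smul_apply, smul_eq_mul, coe_totOp_pow,
        Submodule.coe_sub, Pi.sub_apply, hcoe]
      rfl
    · rw [Subtype.ext_iff, funext_iff]
      refine forall_congr' fun p => ?_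
      rw [Submodule.coe_sub, Pi.sub_apply, Submodule.coe_sum, Finset.sum_apply]
      simp only [Submodule.coe_smul, Pi.smul_apply, smul_eq_mul, coe_totOp_pow, hcoe]
      rfl
end
end

section
/- Let n ≥ 1 and s ≥ 1, and let E_i (i = 1,…,n) be smooth functions of the jet variables (t, y₀, …, y_s). Then the following two systems of partial differential equations are equivalent (one holds identically if and only if the other does): System I: (1) ∂E_i/∂y₀^j − ∂E_j/∂y₀^i + Σ_{k=0}^{s} (−1)^k D_t^k (∂E_i/∂y_k^j − ∂E_j/∂y_k^i) = 0 for all i, j, together with (2) ∂E_i/∂y_r^j − Σ_{k=r}^{s} (−1)^k (k!/((k−r)! r!)) D_t^{k−r} (∂E_j/∂y_k^i) = 0 for all i, j and all 1 ≤ r ≤ s. System II: equations (2) for the extended range 0 ≤ r ≤ s, i.e. including the case r = 0: ∂E_i/∂y₀^j − Σ_{k=0}^{s} (−1)^k D_t^k (∂E_j/∂y_k^i) = 0. -/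
noncomputable section

/-- The submodule of smooth functions on a jet space. -/
def smoothJ (n N : ℕ) : Submodule ℝ (Jet n N → ℝ) where
  carrier := {F | ContDiff ℝ (⊤ : ℕ∞) F}
  add_mem' {F G} hF hG := by
    rw [Set.mem_ofPred_eq] at hF hG ⊢
    exact hF.add hG
  zero_mem' := by
    rw [Set.mem_ofPred_eq]
    exact contDiff_const
  smul_mem' c F hF := by
    rw [Set.mem_ofPred_eq] at hF ⊢
    exact contDiff_const.smul hF

theorem mem_smoothJ {n N : ℕ} {F : Jet n N → ℝ} :
    F ∈ smoothJ n N ↔ ContDiff ℝ (⊤ : ℕ∞) F :=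
  Iff.rfl

theorem contDiff_fderiv_apply_const {V : Type*} [NormedAddCommGroup V] [NormedSpace ℝ V]
    {F : V → ℝ} (hF : ContDiff ℝ (⊤ : ℕ∞) F) (v : V) :
    ContDiff ℝ (⊤ : ℕ∞) (fun p => fderiv ℝ F p v) :=
  (hF.fderiv_right (m := (⊤ : ℕ∞)) (by simp)).clm_apply contDiff_const

theorem contDiff_coord {n N : ℕ} (r : ℕ) (i : Fin n) :
    ContDiff ℝ (⊤ : ℕ∞) (fun p : Jet n N => coord p r i) := by
  unfold coord
  split_ifs <;> fun_prop

theorem contDiff_pderY {n N : ℕ} (r : ℕ) (i : Fin n) {F : Jet n N → ℝ}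
    (hF : ContDiff ℝ (⊤ : ℕ∞) F) : ContDiff ℝ (⊤ : ℕ∞) (pderY r i F) :=
  contDiff_fderiv_apply_const hF _

theorem contDiff_totD {n N : ℕ} {F : Jet n N → ℝ}
    (hF : ContDiff ℝ (⊤ : ℕ∞) F) : ContDiff ℝ (⊤ : ℕ∞) (totD F) :=
  (contDiff_fderiv_apply_const hF _).add <| ContDiff.sum fun r _ => ContDiff.sum fun i _ =>
    (contDiff_coord (r + 1) i).mul (contDiff_pderY r i hF)

theorem contDiff_extJ {n N M : ℕ} (h : N ≤ M) {F : Jet n N → ℝ}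
    (hF : ContDiff ℝ (⊤ : ℕ∞) F) : ContDiff ℝ (⊤ : ℕ∞) (extJ h F) :=
  hF.comp (f := fun p : Jet n M => ((p.1, fun r => p.2 (Fin.castLE h r)) : Jet n N))
    (by fun_prop)

theorem totD_add {n N : ℕ} {F G : Jet n N → ℝ} (hF : Differentiable ℝ F)
    (hG : Differentiable ℝ G) : totD (F + G) = totD F + totD G := by
  funext p
  simp only [totD, pderT, pderY, Pi.add_apply, fderiv_add (hF p) (hG p),
    add_apply, mul_add, Finset.sum_add_distrib]
  ring

theorem totD_smul {n N : ℕ} (c : ℝ) {F : Jet n N → ℝ} (hF : Differentiable ℝ F) :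
    totD (c • F) = c • totD F := by
  funext p
  simp only [totD, pderT, pderY, Pi.smul_apply, fderiv_const_smul (hF p),
    smul_apply, smul_eq_mul, mul_add, Finset.mul_sum, mul_left_comm c]

theorem differentiable_of_mem_smoothJ {n N : ℕ} {F : Jet n N → ℝ} (hF : F ∈ smoothJ n N) :
    Differentiable ℝ F :=
  (mem_smoothJ.1 hF).differentiable (by simp)

/-- The total derivative as an endomorphism of the smooth functions. -/
def totDEnd (n N : ℕ) : Module.End ℝ (smoothJ n N) where
  toFun F := ⟨totD F, mem_smoothJ.2 (contDiff_totD (mem_smoothJ.1 F.2))⟩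
  map_add' F G := Subtype.ext (totD_add (differentiable_of_mem_smoothJ F.2)
    (differentiable_of_mem_smoothJ G.2))
  map_smul' c F := Subtype.ext (totD_smul c (differentiable_of_mem_smoothJ F.2))

theorem coe_totDEnd_pow {n N : ℕ} (k : ℕ) (F : smoothJ n N) :
    ((totDEnd n N ^ k) F : Jet n N → ℝ) = totD^[k] F := by
  induction k with
  | zero => rfl
  | succ k ih =>
    rw [pow_succ', Function.iterate_succ_apply', ← ih]
    rfl

theorem sum_Icc_one_neg_one_pow_mul_choose {k : ℕ} (hk : 1 ≤ k) :
    ∑ r ∈ Finset.Icc 1 k, (-1 : ℝ) ^ r * (k.choose r : ℝ) = -1 := by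
  have h := Int.alternating_sum_range_choose_of_ne (n := k) (by omega)
  rw [Finset.range_eq_Ico, Finset.sum_eq_sum_Ico_succ_bot (by omega)] at h
  have h' : ∑ r ∈ Finset.Icc 1 k, (-1 : ℤ) ^ r * (k.choose r : ℤ) = -1 := by
    rw [← Finset.Ico_add_one_right_eq_Icc]
    simpa using eq_neg_of_add_eq_zero_right h
  exact_mod_cast h'

/-- If `b` is obtained from `a` by the adjoint relations in positive degree, then the
positive-degree parts of the formal adjoints of `a` and `b` are opposite. -/
theorem sum_adjoint_eq_neg {V : Type*} [AddCommGroup V] [Module ℝ V] (D : Module.End ℝ V)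
    (s : ℕ) (a b : ℕ → V)
    (h : ∀ r, 1 ≤ r → r ≤ s →
      b r = ∑ k ∈ Finset.Icc r s, ((-1 : ℝ) ^ k * (k.choose r : ℝ)) • (D ^ (k - r)) (a k)) :
    ∑ r ∈ Finset.Icc 1 s, (-1 : ℝ) ^ r • (D ^ r) (b r) =
      -∑ k ∈ Finset.Icc 1 s, (-1 : ℝ) ^ k • (D ^ k) (a k) := by
  have expand : ∀ r ∈ Finset.Icc 1 s, (-1 : ℝ) ^ r • (D ^ r) (b r) =
      ∑ k ∈ Finset.Icc r s,
        ((-1 : ℝ) ^ r * (k.choose r : ℝ)) • (-1 : ℝ) ^ k • (D ^ k) (a k) := by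
    intro r hr
    rw [Finset.mem_Icc] at hr
    rw [h r hr.1 hr.2, map_sum, Finset.smul_sum]
    refine Finset.sum_congr rfl fun k hk => ?_
    rw [Finset.mem_Icc] at hk
    rw [map_smul, ← Module.End.mul_apply, ← pow_add, Nat.add_sub_cancel' hk.1, smul_smul,
      smul_smul]
    congr 1
    ring
  rw [Finset.sum_congr rfl expand, Finset.sum_comm' (t' := Finset.Icc 1 s)
    (s' := fun k => Finset.Icc 1 k) (by simp only [Finset.mem_Icc]; omega),
    ← Finset.sum_neg_distrib]
  refine Finset.sum_congr rfl fun k hk => ?_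
  rw [← Finset.sum_smul, sum_Icc_one_neg_one_pow_mul_choose (Finset.mem_Icc.1 hk).1, neg_one_smul]

theorem sum_range_succ_eq_zero_add_Icc {V : Type*} [AddCommMonoid V] (f : ℕ → V) (s : ℕ) :
    ∑ k ∈ Finset.range (s + 1), f k = f 0 + ∑ k ∈ Finset.Icc 1 s, f k := by
  rw [Finset.range_eq_Ico, Finset.sum_eq_sum_Ico_succ_bot (by omega), zero_add,
    Finset.Ico_add_one_right_eq_Icc]

/-- Abstract form of the equivalence, for a linear operator `D` and elements `a i j k`
playing the role of `∂E_i/∂y_k^j`. -/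
theorem adjoint_system_iff {V ι : Type*} [AddCommGroup V] [Module ℝ V] (D : Module.End ℝ V)
    (s : ℕ) (a : ι → ι → ℕ → V) :
    ((∀ i j, a i j 0 - a j i 0
        + ∑ k ∈ Finset.range (s + 1), (-1 : ℝ) ^ k • (D ^ k) (a i j k - a j i k) = 0) ∧
      (∀ r, 1 ≤ r → r ≤ s → ∀ i j, a i j r - ∑ k ∈ Finset.Icc r s,
        ((-1 : ℝ) ^ k * (k.choose r : ℝ)) • (D ^ (k - r)) (a j i k) = 0)) ↔
    (∀ r, r ≤ s → ∀ i j, a i j r - ∑ k ∈ Finset.Icc r s,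
        ((-1 : ℝ) ^ k * (k.choose r : ℝ)) • (D ^ (k - r)) (a j i k) = 0) := by
  set Q : ι → ι → V := fun i j => ∑ k ∈ Finset.Icc 1 s, (-1 : ℝ) ^ k • (D ^ k) (a i j k) with hQ
  have skew (i j) : ∑ k ∈ Finset.range (s + 1), (-1 : ℝ) ^ k • (D ^ k) (a i j k - a j i k)
      = a i j 0 + Q i j - (a j i 0 + Q j i) := by
    simp only [map_sub, smul_sub, Finset.sum_sub_distrib, sum_range_succ_eq_zero_add_Icc, hQ,
      pow_zero, one_smul, Module.End.one_apply]
  have zeroth (i j) : ∑ k ∈ Finset.Icc 0 s,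
      ((-1 : ℝ) ^ k * (k.choose 0 : ℝ)) • (D ^ (k - 0)) (a j i k) = a j i 0 + Q j i := by
    rw [← Finset.Ico_add_one_right_eq_Icc, ← Finset.range_eq_Ico]
    simp [sum_range_succ_eq_zero_add_Icc, hQ]
  constructor
  · rintro ⟨h1, h2⟩ r hr i j
    rcases Nat.eq_zero_or_pos r with rfl | hpos
    · rw [zeroth]
      have h1' := h1 i j
      rw [skew] at h1'
      have hneg : Q i j = -Q j i := sum_adjoint_eq_neg D s (a j i) (a i j)
        fun r hr hrs => sub_eq_zero.1 (h2 r hr hrs i j)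
      rw [hneg] at h1'
      have hdouble : (2 : ℝ) • (a i j 0 - (a j i 0 + Q j i)) = 0 := by
        rw [← h1']
        module
      exact (smul_eq_zero.1 hdouble).resolve_left two_ne_zero
    · exact h2 r hpos hr i j
  · intro h
    refine ⟨fun i j => ?_, fun r _ hr => h r hr⟩
    have hij := h 0 s.zero_le i j
    have hji := h 0 s.zero_le j i
    rw [zeroth] at hij hji
    rw [skew]
    calc _ = (a i j 0 - (a j i 0 + Q j i)) - (a j i 0 - (a i j 0 + Q i j)) := by abel
      _ = 0 := by rw [hij, hji, sub_zero]

/-- For a system `E_i` of smooth functions of the jet variables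
`(t, y₀, …, y_s)`, System I (equations (1) together with (2) for `1 ≤ r ≤ s`) holds
identically if and only if System II (equations (2) for the extended range `0 ≤ r ≤ s`)
holds identically. -/
theorem statement_1 (n s : ℕ) (hn : 1 ≤ n) (hs : 1 ≤ s)
    (E : Fin n → (ℝ × (Fin (s + 1) → Fin n → ℝ)) → ℝ)
    (hE : ∀ i, ContDiff ℝ (⊤ : ℕ∞) (E i)) :
    ((∀ (i j : Fin n) (p : Jet n (2 * s + 1)),
        pderY 0 j (extJ (n := n) (by omega) (E i)) p
          - pderY 0 i (extJ (n := n) (by omega) (E j)) p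
          + ∑ k ∈ Finset.range (s + 1), (-1 : ℝ) ^ k *
              totD^[k] (fun q => pderY k j (extJ (n := n) (by omega) (E i)) q
                - pderY k i (extJ (n := n) (by omega) (E j)) q) p = 0)
      ∧ (∀ r : ℕ, 1 ≤ r → r ≤ s → ∀ (i j : Fin n) (p : Jet n (2 * s + 1)),
          pderY r j (extJ (n := n) (by omega) (E i)) p
            - ∑ k ∈ Finset.Icc r s, (-1 : ℝ) ^ k * (k.choose r : ℝ) *
                totD^[k - r] (pderY k i (extJ (n := n) (by omega) (E j))) p = 0)) ↔
    (∀ r : ℕ, r ≤ s → ∀ (i j : Fin n) (p : Jet n (2 * s + 1)),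
        pderY r j (extJ (n := n) (by omega) (E i)) p
          - ∑ k ∈ Finset.Icc r s, (-1 : ℝ) ^ k * (k.choose r : ℝ) *
              totD^[k - r] (pderY k i (extJ (n := n) (by omega) (E j))) p = 0) := by
  have hle : s + 1 ≤ 2 * s + 1 := by omega
  have key := adjoint_system_iff (totDEnd n (2 * s + 1)) s
    (fun i j k => (⟨pderY k j (extJ hle (E i)),
      mem_smoothJ.2 (contDiff_pderY k j (contDiff_extJ hle (hE i)))⟩ :
      smoothJ n (2 * s + 1)))
  simp only [← Submodule.coe_eq_zero, Submodule.coe_add, Submodule.coe_sub, Submodule.coe_sum,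
    Submodule.coe_smul, coe_totDEnd_pow, funext_iff, Pi.add_apply, Pi.sub_apply,
    Finset.sum_apply, Pi.smul_apply, smul_eq_mul, Pi.zero_apply] at key
  exact key
end
end

section
/- (No-go theorem for invariant third-order equations, Euclidean-signature case.) Let U ⊆ ℝ³ be a nonempty open set and let A: U → ℝ^{3×3} be a smooth map such that A(v) is skew-symmetric for every v ∈ U. Suppose that for every vector π ∈ ℝ³ and every skew-symmetric matrix Ω ∈ ℝ^{3×3} there exists a smooth matrix-valued map Φ: U → ℝ^{3×3} such that, identically on U, ((π·∇)A)(v) + (π·v) ((v·∇)A)(v) + (((Ωv)·∇)A)(v) + 2 (π·v) A(v) + (A(v)v) π^T − A(v) Ω = Φ(v) A(v), where π·v is the Euclidean inner product on ℝ³, (π·∇)A denotes the entrywise directional derivative of A in the direction π, and (A(v)v) π^T is the rank-one matrix with entries (A(v)v)_i π_j. Then A ≡ 0 on U. -/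
open Matrix

/-- The generators vanishing at `v` are parameterized by the axis `![p, q, r]` of the rotation;
there the invariance condition, applied to the kernel vector `![A v 1 2, -A v 0 2, A v 0 1]`
of `A v`, is an algebraic relation. -/
theorem isotropy_relation {U : Set (Fin 3 → ℝ)} {A : (Fin 3 → ℝ) → Matrix (Fin 3) (Fin 3) ℝ}
    (hsym : ∀ (π : Fin 3 → ℝ) (Ω : Matrix (Fin 3) (Fin 3) ℝ), Ωᵀ = -Ω →
      ∃ Φ : (Fin 3 → ℝ) → Matrix (Fin 3) (Fin 3) ℝ, ∀ v ∈ U, ∀ (i j : Fin 3),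
          fderiv ℝ (fun u => A u i j) v π
            + (∑ k, π k * v k) * fderiv ℝ (fun u => A u i j) v v
            + fderiv ℝ (fun u => A u i j) v (Ω.mulVec v)
            + 2 * (∑ k, π k * v k) * A v i j
            + (A v).mulVec v i * π j
            - (A v * Ω) i j
          = (Φ v * A v) i j)
    {v : Fin 3 → ℝ} (hv : v ∈ U) (hskew : (A v)ᵀ = -A v) (p q r : ℝ) (i : Fin 3) :
    (A v *ᵥ v) i * ((r * v 1 - q * v 2) * A v 1 2 - (p * v 2 - r * v 0) * A v 0 2
        + (q * v 0 - p * v 1) * A v 0 1)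
      = A v i 0 * (-r * -A v 0 2 + q * A v 0 1) + A v i 1 * (r * A v 1 2 - p * A v 0 1)
        + A v i 2 * (-q * A v 1 2 + p * -A v 0 2) := by
  set Ω : Matrix (Fin 3) (Fin 3) ℝ := !![0, -r, q; r, 0, -p; -q, p, 0] with hΩ
  have hΩskew : Ωᵀ = -Ω := by
    ext i j
    fin_cases i <;> fin_cases j <;> simp [hΩ]
  obtain ⟨Φ, hΦ⟩ := hsym (-(Ω *ᵥ v)) Ω hΩskew
  have horth : ∑ k, (-(Ω *ᵥ v)) k * v k = 0 := by
    simp [hΩ, dotProduct, Fin.sum_univ_three]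
    ring
  have hs (i j : Fin 3) : A v j i = -A v i j := congrFun (congrFun hskew i) j
  have h (j : Fin 3) := hΦ v hv i j
  simp only [horth, map_neg, zero_mul, mul_zero, add_zero, neg_add_cancel, zero_add] at h
  have h0 := h 0
  have h1 := h 1
  have h2 := h 2
  simp only [Matrix.mul_apply, Fin.sum_univ_three, Pi.neg_apply] at h0 h1 h2
  rw [hs 0 1, hs 0 2, show A v 0 0 = 0 by linarith [hs 0 0]] at h0
  rw [hs 1 2, show A v 1 1 = 0 by linarith [hs 1 1]] at h1
  rw [show A v 2 2 = 0 by linarith [hs 2 2]] at h2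
  generalize (A v *ᵥ v) i = w at *
  simp [hΩ, dotProduct, Fin.sum_univ_three] at h0 h1 h2
  linear_combination A v 1 2 * h0 - A v 0 2 * h1 + A v 0 1 * h2

/-- no-go theorem for invariant third-order equations, Euclidean
signature. If a smooth field `A` of skew-symmetric `3×3` matrices on a nonempty open set
`U ⊆ ℝ³` satisfies the infinitesimal invariance condition with respect to all generators
of the Euclidean isometry group (parameterized by `π ∈ ℝ³` and skew-symmetric `Ω`), with
some smooth matrix multiplier `Φ`, then `A` vanishes identically on `U`. -/
theorem statement_7 (U : Set (Fin 3 → ℝ)) (hU : IsOpen U) (hne : U.Nonempty)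
    (A : (Fin 3 → ℝ) → Matrix (Fin 3) (Fin 3) ℝ)
    (hA : ∀ i j, ContDiffOn ℝ (⊤ : ℕ∞) (fun v => A v i j) U)
    (hskew : ∀ v ∈ U, (A v)ᵀ = - A v)
    (hsym : ∀ (π : Fin 3 → ℝ) (Ω : Matrix (Fin 3) (Fin 3) ℝ), Ωᵀ = -Ω →
      ∃ Φ : (Fin 3 → ℝ) → Matrix (Fin 3) (Fin 3) ℝ,
        (∀ i j, ContDiffOn ℝ (⊤ : ℕ∞) (fun v => Φ v i j) U) ∧
        ∀ v ∈ U, ∀ (i j : Fin 3),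
          fderiv ℝ (fun u => A u i j) v π
            + (∑ k, π k * v k) * fderiv ℝ (fun u => A u i j) v v
            + fderiv ℝ (fun u => A u i j) v (Ω.mulVec v)
            + 2 * (∑ k, π k * v k) * A v i j
            + (A v).mulVec v i * π j
            - (A v * Ω) i j
          = (Φ v * A v) i j) :
    ∀ v ∈ U, A v = 0 := by
  intro v hv
  have hs (i j : Fin 3) : A v j i = -A v i j := congrFun (congrFun (hskew v hv) i) j
  have key := isotropy_relation (fun π Ω hΩ => (hsym π Ω hΩ).imp fun _ h => h.2) hv (hskew v hv)
  have d0 : A v 0 0 = 0 := by linarith [hs 0 0]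
  have d1 : A v 1 1 = 0 := by linarith [hs 1 1]
  have d2 : A v 2 2 = 0 := by linarith [hs 2 2]
  have e0 (p q r : ℝ) := key p q r 0
  have e1 (p q r : ℝ) := key p q r 1
  have e2 (p q r : ℝ) := key p q r 2
  simp only [Matrix.mulVec, dotProduct, Fin.sum_univ_three, hs 0 1, hs 0 2, hs 1 2, d0, d1, d2]
    at e0 e1 e2
  have hx := e0 1 0 0
  have hz := e2 0 0 1
  have hnorm : (A v 0 1 * v 1 + A v 0 2 * v 2) ^ 2 + (-A v 0 1 * v 0 + A v 1 2 * v 2) ^ 2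
      + (-A v 0 2 * v 0 + -A v 1 2 * v 1) ^ 2 = 0 := by
    linear_combination v 0 * e0 (v 0) (v 1) (v 2) + v 1 * e1 (v 0) (v 1) (v 2)
      + v 2 * e2 (v 0) (v 1) (v 2)
  have c0 : A v 0 1 * v 1 + A v 0 2 * v 2 = 0 := by
    refine pow_eq_zero_iff two_ne_zero |>.mp (le_antisymm ?_ (sq_nonneg _))
    nlinarith [sq_nonneg (-A v 0 1 * v 0 + A v 1 2 * v 2),
      sq_nonneg (-A v 0 2 * v 0 + -A v 1 2 * v 1)]
  have c2 : -A v 0 2 * v 0 + -A v 1 2 * v 1 = 0 := by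
    refine pow_eq_zero_iff two_ne_zero |>.mp (le_antisymm ?_ (sq_nonneg _))
    nlinarith [sq_nonneg (-A v 0 1 * v 0 + A v 1 2 * v 2),
      sq_nonneg (A v 0 1 * v 1 + A v 0 2 * v 2)]
  rw [zero_mul, zero_add, c0] at hx
  rw [zero_mul, add_zero, c2] at hz
  have x0 : A v 0 1 = 0 := by nlinarith [sq_nonneg (A v 0 1), sq_nonneg (A v 0 2)]
  have y0 : A v 0 2 = 0 := by nlinarith [sq_nonneg (A v 0 1), sq_nonneg (A v 0 2)]
  have z0 : A v 1 2 = 0 := by nlinarith [sq_nonneg (A v 1 2), sq_nonneg (A v 0 2)]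
  ext i j
  fin_cases i <;> fin_cases j <;> simp [d0, d1, d2, x0, y0, z0, hs 0 1, hs 0 2, hs 1 2]
end

section
/- Let U ⊆ ℝ³ be a nonempty open set and let 𝔞: U → ℝ³ be a smooth map. Suppose that identically on U: (i) for every π ∈ ℝ³: 𝔞 × ((π·∇)𝔞) + (π·v) (𝔞 × ((v·∇)𝔞)) − (π·𝔞) (𝔞 × v) = 0, and (ii) for every ω ∈ ℝ³: 𝔞 × (((ω×v)·∇)𝔞) − 𝔞 × (ω × 𝔞) = 0, where v denotes the point of U, × is the Euclidean cross product on ℝ³, · the Euclidean inner product, and (π·∇)𝔞 the directional derivative of 𝔞 in the direction π. Then 𝔞 ≡ 0 on U. -/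
/-- If the map `ω ↦ b × (ω × b)` takes values in the line spanned by `b × v`, then `b = 0`. -/
theorem eq_zero_of_forall_cross_cross_mem_line (b v : Fin 3 → ℝ)
    (h : ∀ ω : Fin 3 → ℝ, ∃ c : ℝ, crossProduct b (crossProduct ω b) = c • crossProduct b v) :
    b = 0 := by
  have hdot : ∀ ω : Fin 3 → ℝ, ω ⬝ᵥ b = 0 → ω ⬝ᵥ crossProduct b v = 0 →
      (b ⬝ᵥ b) * (ω ⬝ᵥ ω) = 0 := by
    intro ω hb hw
    obtain ⟨c, hc⟩ := h ω
    have := congrArg (fun x => ω ⬝ᵥ x) hc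
    simp only [dotProduct_smul, hw, smul_zero] at this
    simp only [cross_apply, Matrix.vec3_dotProduct, Matrix.cons_val] at this hb ⊢
    linear_combination this + (ω 0 * b 0 + ω 1 * b 1 + ω 2 * b 2) * hb
  by_contra hb
  have key : ∀ ω : Fin 3 → ℝ, ω ⬝ᵥ b = 0 → ω ⬝ᵥ crossProduct b v = 0 → ω = 0 := fun ω h₁ h₂ =>
    dotProduct_self_eq_zero.1 ((mul_eq_zero.1 (hdot ω h₁ h₂)).resolve_left
      fun h₀ => hb (dotProduct_self_eq_zero.1 h₀))
  have hbw : crossProduct b (crossProduct b v) = 0 :=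
    key _ (by rw [dotProduct_comm, dot_self_cross]) (by rw [dotProduct_comm, dot_cross_self])
  have hw : crossProduct b v = 0 := by
    have hsq : (b ⬝ᵥ b) * (crossProduct b v ⬝ᵥ crossProduct b v) = 0 := by
      have := congrArg (fun x => x ⬝ᵥ x) hbw
      simpa [cross_dot_cross b (crossProduct b v) b] using this
    exact dotProduct_self_eq_zero.1 ((mul_eq_zero.1 hsq).resolve_left
      fun h₀ => hb (dotProduct_self_eq_zero.1 h₀))
  have hzero : ∀ ω : Fin 3 → ℝ, crossProduct b (crossProduct ω b) = 0 := by
    intro ω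
    obtain ⟨c, hc⟩ := h ω
    rw [hc, hw, smul_zero]
  have h₀ := congrFun (hzero ![1, 0, 0]) 0
  have h₁ := congrFun (hzero ![0, 1, 0]) 1
  have h₂ := congrFun (hzero ![0, 0, 1]) 2
  simp [cross_apply] at h₀ h₁ h₂
  refine hb (dotProduct_self_eq_zero.1 ?_)
  rw [Matrix.vec3_dotProduct]
  linarith

/-- A map `F` satisfying the first contracted identity is, modulo `b`, of rank at most one. -/
theorem exists_cross_map_eq_smul (b v : Fin 3 → ℝ) (F : (Fin 3 → ℝ) → Fin 3 → ℝ)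
    (h : ∀ π : Fin 3 → ℝ, crossProduct b (F π) + (π ⬝ᵥ v) • crossProduct b (F v)
      - (π ⬝ᵥ b) • crossProduct b v = 0) (π : Fin 3 → ℝ) :
    ∃ c : ℝ, crossProduct b (F π) = c • crossProduct b v := by
  have hpos : (1 + v ⬝ᵥ v : ℝ) ≠ 0 := by
    rw [Matrix.vec3_dotProduct]
    nlinarith [mul_self_nonneg (v 0), mul_self_nonneg (v 1), mul_self_nonneg (v 2)]
  have hv : crossProduct b (F v) = ((1 + v ⬝ᵥ v)⁻¹ * (v ⬝ᵥ b)) • crossProduct b v := by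
    rw [mul_smul, eq_inv_smul_iff₀ hpos, add_smul, one_smul]
    exact sub_eq_zero.1 (h v)
  refine ⟨π ⬝ᵥ b - (π ⬝ᵥ v) * ((1 + v ⬝ᵥ v)⁻¹ * (v ⬝ᵥ b)), ?_⟩
  have hπ := h π
  rw [hv, smul_smul] at hπ
  rw [sub_smul, eq_sub_iff_add_eq]
  exact sub_eq_zero.1 hπ

/-- contracted invariance identities force the dual vector to vanish.
If a smooth vector field `𝔞` on a nonempty open set `U ⊆ ℝ³` satisfies the two contracted
symmetry identities (i) and (ii) for all parameters `π` resp. `ω`, then `𝔞 ≡ 0` on `U`. -/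
theorem statement_8 (U : Set (Fin 3 → ℝ)) (hU : IsOpen U) (hne : U.Nonempty)
    (a : (Fin 3 → ℝ) → (Fin 3 → ℝ)) (ha : ContDiffOn ℝ (⊤ : ℕ∞) a U)
    (h1 : ∀ (π : Fin 3 → ℝ), ∀ v ∈ U,
      crossProduct (a v) (fderiv ℝ a v π)
        + (∑ k, π k * v k) • crossProduct (a v) (fderiv ℝ a v v)
        - (∑ k, π k * a v k) • crossProduct (a v) v = 0)
    (h2 : ∀ (ω : Fin 3 → ℝ), ∀ v ∈ U,
      crossProduct (a v) (fderiv ℝ a v (crossProduct ω v))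
        - crossProduct (a v) (crossProduct ω (a v)) = 0) :
    ∀ v ∈ U, a v = 0 := by
  intro v hv
  refine eq_zero_of_forall_cross_cross_mem_line (a v) v fun ω => ?_
  rw [← sub_eq_zero.1 (h2 ω v hv)]
  exact exists_cross_map_eq_smul (a v) v (fderiv ℝ a v) (fun π => h1 π v hv) _
end

section
/- Let D = {v = (v₁, v₂) ∈ ℝ² : v₁² + v₂² < 1} be the open unit disc and let a: D → ℝ be smooth and everywhere positive. Write ∂₁, ∂₂ for the partial derivatives, R = v₁∂₂ − v₂∂₁ (the rotation generator) and P = v₁∂₁ + v₂∂₂ (the Euler radial operator). Suppose that identically on D: (Ω1) R(∂₁a) + ∂₂a = (∂₁a/a)·(Ra); (Ω2) R(∂₂a) − ∂₁a = (∂₂a/a)·(Ra); (π11) ∂₁(∂₁a) − v₁ P(∂₁a) − v₁ ∂₁a − Pa = (∂₁a/a)(∂₁a − v₁ Pa) + 3a; (π22) ∂₂(∂₂a) − v₂ P(∂₂a) − v₂ ∂₂a − Pa = (∂₂a/a)(∂₂a − v₂ Pa) + 3a; (π21) ∂₂(∂₁a) − v₂ P(∂₁a) − v₂ ∂₁a =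 (∂₁a/a)(∂₂a − v₂ Pa); (π12) ∂₁(∂₂a) − v₁ P(∂₂a) − v₁ ∂₂a = (∂₂a/a)(∂₁a − v₁ Pa). Then there is a constant C > 0 such that a(v₁, v₂) = C (1 − v₁² − v₂²)^{−3/2} on all of D. -/
noncomputable section

/-- Partial derivative in the first velocity variable. -/
def d1 (f : ℝ × ℝ → ℝ) (v : ℝ × ℝ) : ℝ := fderiv ℝ f v (1, 0)

/-- Partial derivative in the second velocity variable. -/
def d2 (f : ℝ × ℝ → ℝ) (v : ℝ × ℝ) : ℝ := fderiv ℝ f v (0, 1)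

/-- The rotation generator `R = v₁∂₂ − v₂∂₁`. -/
def rotOp (f : ℝ × ℝ → ℝ) (v : ℝ × ℝ) : ℝ := v.1 * d2 f v - v.2 * d1 f v

/-- The Euler radial operator `P = v₁∂₁ + v₂∂₂`. -/
def radOp (f : ℝ × ℝ → ℝ) (v : ℝ × ℝ) : ℝ := v.1 * d1 f v + v.2 * d2 f v

theorem isOpen_unitDisc : IsOpen {v : ℝ × ℝ | v.1 ^ 2 + v.2 ^ 2 < 1} :=
  isOpen_lt (by fun_prop) continuous_const

theorem convex_unitDisc : Convex ℝ {v : ℝ × ℝ | v.1 ^ 2 + v.2 ^ 2 < 1} := by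
  have h := ((even_two.convexOn_pow (𝕜 := ℝ)).comp_linearMap (LinearMap.fst ℝ ℝ ℝ)).add
    ((even_two.convexOn_pow (𝕜 := ℝ)).comp_linearMap (LinearMap.snd ℝ ℝ ℝ))
  simpa using h.convex_lt 1

/-- A function whose gradient is that of `C (1 - |v|²)^{-3/2}`, up to the factor `a`,
is a multiple of that function. -/
theorem eq_const_mul_rpow_of_gradient {a : ℝ × ℝ → ℝ}
    (ha : DifferentiableOn ℝ a {v : ℝ × ℝ | v.1 ^ 2 + v.2 ^ 2 < 1})
    (h1 : ∀ v : ℝ × ℝ, v.1 ^ 2 + v.2 ^ 2 < 1 →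
      (1 - v.1 ^ 2 - v.2 ^ 2) * d1 a v = 3 * a v * v.1)
    (h2 : ∀ v : ℝ × ℝ, v.1 ^ 2 + v.2 ^ 2 < 1 →
      (1 - v.1 ^ 2 - v.2 ^ 2) * d2 a v = 3 * a v * v.2)
    {v : ℝ × ℝ} (hv : v.1 ^ 2 + v.2 ^ 2 < 1) :
    a v = a 0 * (1 - v.1 ^ 2 - v.2 ^ 2) ^ (-(3 : ℝ) / 2) := by
  have hderiv : ∀ w : ℝ × ℝ, w.1 ^ 2 + w.2 ^ 2 < 1 → HasFDerivAt
      (fun w : ℝ × ℝ => a w * (1 - w.1 ^ 2 - w.2 ^ 2) ^ ((3 : ℝ) / 2))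
      (0 : ℝ × ℝ →L[ℝ] ℝ) w := by
    intro w hw
    have hr : 0 < 1 - w.1 ^ 2 - w.2 ^ 2 := by linarith
    have hda := (ha.differentiableAt (isOpen_unitDisc.mem_nhds hw)).hasFDerivAt
    have hdr := (((hasFDerivAt_fst (𝕜 := ℝ) (p := w)).pow 2).const_sub 1).sub
      ((hasFDerivAt_snd (𝕜 := ℝ) (p := w)).pow 2)
    have hmul := hda.mul (hdr.rpow_const (p := (3 : ℝ) / 2) (Or.inl hr.ne'))
    have hpow : (1 - w.1 ^ 2 - w.2 ^ 2) ^ ((3 : ℝ) / 2)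
        = (1 - w.1 ^ 2 - w.2 ^ 2) ^ ((3 : ℝ) / 2 - 1) * (1 - w.1 ^ 2 - w.2 ^ 2) := by
      rw [← Real.rpow_add_one hr.ne']
      norm_num
    have e1 := h1 w hw
    have e2 := h2 w hw
    unfold d1 at e1
    unfold d2 at e2
    refine hmul.congr_fderiv ?_
    ext
    · simp [hpow]
      linear_combination (1 - w.1 ^ 2 - w.2 ^ 2) ^ ((3 : ℝ) / 2 - 1) * e1
    · simp [hpow]
      linear_combination (1 - w.1 ^ 2 - w.2 ^ 2) ^ ((3 : ℝ) / 2 - 1) * e2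
  have hr : 0 < 1 - v.1 ^ 2 - v.2 ^ 2 := by linarith
  have hconst := isOpen_unitDisc.is_const_of_fderiv_eq_zero convex_unitDisc.isPreconnected
    (fun w hw => (hderiv w hw).differentiableAt.differentiableWithinAt)
    (fun w hw => (hderiv w hw).fderiv) hv (show (0 : ℝ × ℝ) ∈ _ by simp)
  have h0 : a v * (1 - v.1 ^ 2 - v.2 ^ 2) ^ ((3 : ℝ) / 2) = a 0 := by simpa using hconst
  rw [← h0, mul_assoc, ← Real.rpow_add hr]
  norm_num

/-- A positive smooth solution `a` on the open unit disc of the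
Poincaré-invariance PDE system (Ω1), (Ω2), (π11), (π22), (π21), (π12) is necessarily
`a(v) = C (1 − v₁² − v₂²)^{-3/2}` for some constant `C > 0`. -/
theorem statement_12 (a : ℝ × ℝ → ℝ)
    (ha : ContDiffOn ℝ (⊤ : ℕ∞) a {v : ℝ × ℝ | v.1 ^ 2 + v.2 ^ 2 < 1})
    (hpos : ∀ v : ℝ × ℝ, v.1 ^ 2 + v.2 ^ 2 < 1 → 0 < a v)
    (hΩ1 : ∀ v : ℝ × ℝ, v.1 ^ 2 + v.2 ^ 2 < 1 →
      rotOp (d1 a) v + d2 a v = d1 a v / a v * rotOp a v)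
    (hΩ2 : ∀ v : ℝ × ℝ, v.1 ^ 2 + v.2 ^ 2 < 1 →
      rotOp (d2 a) v - d1 a v = d2 a v / a v * rotOp a v)
    (hπ11 : ∀ v : ℝ × ℝ, v.1 ^ 2 + v.2 ^ 2 < 1 →
      d1 (d1 a) v - v.1 * radOp (d1 a) v - v.1 * d1 a v - radOp a v
        = d1 a v / a v * (d1 a v - v.1 * radOp a v) + 3 * a v)
    (hπ22 : ∀ v : ℝ × ℝ, v.1 ^ 2 + v.2 ^ 2 < 1 →
      d2 (d2 a) v - v.2 * radOp (d2 a) v - v.2 * d2 a v - radOp a v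
        = d2 a v / a v * (d2 a v - v.2 * radOp a v) + 3 * a v)
    (hπ21 : ∀ v : ℝ × ℝ, v.1 ^ 2 + v.2 ^ 2 < 1 →
      d2 (d1 a) v - v.2 * radOp (d1 a) v - v.2 * d1 a v
        = d1 a v / a v * (d2 a v - v.2 * radOp a v))
    (hπ12 : ∀ v : ℝ × ℝ, v.1 ^ 2 + v.2 ^ 2 < 1 →
      d1 (d2 a) v - v.1 * radOp (d2 a) v - v.1 * d2 a v
        = d2 a v / a v * (d1 a v - v.1 * radOp a v)) :
    ∃ C : ℝ, 0 < C ∧ ∀ v : ℝ × ℝ, v.1 ^ 2 + v.2 ^ 2 < 1 →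
      a v = C * (1 - v.1 ^ 2 - v.2 ^ 2) ^ (-(3 : ℝ) / 2) := by
  have key : ∀ v : ℝ × ℝ, v.1 ^ 2 + v.2 ^ 2 < 1 →
      d1 a v - v.1 * radOp a v = 3 * a v * v.1 ∧ d2 a v - v.2 * radOp a v = 3 * a v * v.2 := by
    intro v hv
    have o1 := hΩ1 v hv
    have o2 := hΩ2 v hv
    have p11 := hπ11 v hv
    have p22 := hπ22 v hv
    have p21 := hπ21 v hv
    have p12 := hπ12 v hv
    simp only [rotOp, radOp] at *
    constructor
    · linear_combination -o2 + v.1 * p22 - v.2 * p12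
    · linear_combination o1 - v.1 * p21 + v.2 * p11
  refine ⟨a 0, hpos 0 (by simp), fun v hv =>
    eq_const_mul_rpow_of_gradient (ha.differentiableOn (by simp)) ?_ ?_ hv⟩
  · intro w hw
    obtain ⟨k1, k2⟩ := key w hw
    simp only [radOp] at k1 k2
    linear_combination (1 - w.2 ^ 2) * k1 + w.1 * w.2 * k2
  · intro w hw
    obtain ⟨k1, k2⟩ := key w hw
    simp only [radOp] at k1 k2
    linear_combination (1 - w.1 ^ 2) * k2 + w.1 * w.2 * k1
end
end

section
/- Fix μ ∈ ℝ. On the set {(v, w) ∈ ℝ² × ℝ² : v₁² + v₂² < 1, v₂² < 1, v₁² < 1} define the two Lagrange functions L₁(v, w) = − w₂ v₁ / ( √(1 − v₁² − v₂²) · (1 − v₂²) ) + μ √(1 − v₁² − v₂²) and L₂(v, w) = w₁ v₂ / ( √(1 − v₁² − v₂²) · (1 − v₁²) ) + μ √(1 − v₁² − v₂²). Then for both L = L₁ and L = L₂ one has, identically on this set: ∂²L/∂w₁∂v₂ − ∂²L/∂w₂∂v₁ = (1 − v₁² − v₂²)^{−3/2}. In particular, the two Lagrangians have the same skew-symmetric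 Helmholtz coefficient matrix A with A₁₂ = (1 − v₁² − v₂²)^{−3/2}. -/
noncomputable section

/-- The first Lagrange function `L₁(v,w) = −w₂v₁/(√(1−v₁²−v₂²)(1−v₂²)) + μ√(1−v₁²−v₂²)`;
the argument is `(v, w) = ((v₁,v₂),(w₁,w₂))`. -/
def LagOne (μ : ℝ) (p : (ℝ × ℝ) × (ℝ × ℝ)) : ℝ :=
  -(p.2.2 * p.1.1) / (Real.sqrt (1 - p.1.1 ^ 2 - p.1.2 ^ 2) * (1 - p.1.2 ^ 2))
    + μ * Real.sqrt (1 - p.1.1 ^ 2 - p.1.2 ^ 2)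

/-- The second Lagrange function `L₂(v,w) = w₁v₂/(√(1−v₁²−v₂²)(1−v₁²)) + μ√(1−v₁²−v₂²)`. -/
def LagTwo (μ : ℝ) (p : (ℝ × ℝ) × (ℝ × ℝ)) : ℝ :=
  p.2.1 * p.1.2 / (Real.sqrt (1 - p.1.1 ^ 2 - p.1.2 ^ 2) * (1 - p.1.1 ^ 2))
    + μ * Real.sqrt (1 - p.1.1 ^ 2 - p.1.2 ^ 2)

/-- The mixed second derivative, in a velocity direction `e` and an acceleration direction `u`,
of a function that is affine in the acceleration. -/
theorem fderiv_fderiv_affine_snd {E F : Type*} [NormedAddCommGroup E] [NormedSpace ℝ E]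
    [NormedAddCommGroup F] [NormedSpace ℝ F] (α : F →L[ℝ] ℝ) {f g : E → ℝ} {p : E × F}
    (hf : ContDiffAt ℝ 2 f p.1) (hg : ContDiffAt ℝ 2 g p.1) (e : E) (u : F) :
    fderiv ℝ (fun q => fderiv ℝ (fun r : E × F => α r.2 * f r.1 + g r.1) q (e, 0)) p (0, u)
      = α u * fderiv ℝ f p.1 e := by
  have first : (fun q => fderiv ℝ (fun r : E × F => α r.2 * f r.1 + g r.1) q (e, 0))
      =ᶠ[nhds p] fun q => α q.2 * fderiv ℝ f q.1 e + fderiv ℝ g q.1 e := by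
    have ev : ∀ {h : E → ℝ}, ContDiffAt ℝ 2 h p.1 →
        ∀ᶠ q : E × F in nhds p, DifferentiableAt ℝ h q.1 := fun hh =>
      continuousAt_fst.eventually
        ((hh.eventually (by simp)).mono fun _ h => h.differentiableAt (by simp))
    filter_upwards [ev hf, ev hg] with q hfq hgq
    have hα : HasFDerivAt (fun r : E × F => α r.2) (α.comp (.snd ℝ E F)) q :=
      (α.comp (.snd ℝ E F)).hasFDerivAt
    have hf' : HasFDerivAt (fun r : E × F => f r.1) ((fderiv ℝ f q.1).comp (.fst ℝ E F)) q :=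
      hfq.hasFDerivAt.comp q hasFDerivAt_fst
    have hg' : HasFDerivAt (fun r : E × F => g r.1) ((fderiv ℝ g q.1).comp (.fst ℝ E F)) q :=
      hgq.hasFDerivAt.comp q hasFDerivAt_fst
    refine (congrArg (fun T => T (e, 0)) ((hα.mul hf').add hg').fderiv).trans ?_
    simp
  rw [first.fderiv_eq]
  have second : ∀ {h : E → ℝ}, ContDiffAt ℝ 2 h p.1 →
      DifferentiableAt ℝ (fun x => fderiv ℝ h x e) p.1 := fun hh =>
    ((hh.fderiv_right (m := 1) (by norm_num)).differentiableAt (by simp)).clm_apply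
      (differentiableAt_const e)
  have hα : HasFDerivAt (fun r : E × F => α r.2) (α.comp (.snd ℝ E F)) p :=
    (α.comp (.snd ℝ E F)).hasFDerivAt
  have hf' := (second hf).hasFDerivAt.comp p hasFDerivAt_fst
  have hg' := (second hg).hasFDerivAt.comp p hasFDerivAt_fst
  have total := ((hα.mul hf').add hg').fderiv
  simp only [Function.comp_def] at total
  refine (congrArg (fun T => T (0, u)) total).trans ?_
  simp [mul_comm]

/-- The derivative of `x ↦ x / (√(1 - x² - y²) (1 - y²))` is `(1 - x² - y²)^(-3/2)`. -/
theorem hasDerivAt_div_sqrt_one_sub_sq_sub_sq {x y : ℝ} (h : x ^ 2 + y ^ 2 < 1) :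
    HasDerivAt (fun t => t / (Real.sqrt (1 - t ^ 2 - y ^ 2) * (1 - y ^ 2)))
      ((1 - x ^ 2 - y ^ 2) ^ (-(3 : ℝ) / 2)) x := by
  have hs : 0 < 1 - x ^ 2 - y ^ 2 := by linarith
  have hy : 1 - y ^ 2 ≠ 0 := by nlinarith [sq_nonneg x]
  have hr : 0 < Real.sqrt (1 - x ^ 2 - y ^ 2) := Real.sqrt_pos.2 hs
  have hpoly : HasDerivAt (fun t : ℝ => 1 - t ^ 2 - y ^ 2) (-(2 * x)) x := by
    simpa using (((hasDerivAt_id x).pow 2).const_sub 1).sub_const (y ^ 2)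
  have hpow : (1 - x ^ 2 - y ^ 2) ^ (-(3 : ℝ) / 2) = (Real.sqrt (1 - x ^ 2 - y ^ 2) ^ 3)⁻¹ := by
    rw [Real.sqrt_eq_rpow, ← Real.rpow_natCast (_ ^ (1 / 2 : ℝ)), ← Real.rpow_mul hs.le, ← Real.rpow_neg hs.le]
    norm_num
  have hquot := (hasDerivAt_id x).div ((hpoly.sqrt hs.ne').mul_const (1 - y ^ 2))
    (mul_ne_zero hr.ne' hy)
  refine hquot.congr_deriv ?_
  rw [hpow]
  have hsq := Real.sq_sqrt hs.le
  simp only [id]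
  generalize Real.sqrt (1 - x ^ 2 - y ^ 2) = r at *
  field_simp
  linear_combination hsq

theorem contDiffAt_sqrt_one_sub_sq_sub_sq {v : ℝ × ℝ} (h : v.1 ^ 2 + v.2 ^ 2 < 1) {n : ℕ∞} :
    ContDiffAt ℝ n (fun v : ℝ × ℝ => Real.sqrt (1 - v.1 ^ 2 - v.2 ^ 2)) v :=
  ContDiffAt.sqrt (by fun_prop) (by linarith)

/-- Both Lagrangians `L₁`, `L₂` have the same skew-symmetric Helmholtz
coefficient `A₁₂ = ∂²L/∂w₁∂v₂ − ∂²L/∂w₂∂v₁ = (1 − v₁² − v₂²)^{-3/2}` on the set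
`{v₁² + v₂² < 1, v₂² < 1, v₁² < 1}`. -/
theorem statement_13 (μ : ℝ) :
    ∀ p : (ℝ × ℝ) × (ℝ × ℝ),
      p.1.1 ^ 2 + p.1.2 ^ 2 < 1 → p.1.2 ^ 2 < 1 → p.1.1 ^ 2 < 1 →
      (fderiv ℝ (fun q => fderiv ℝ (LagOne μ) q ((0, 1), (0, 0))) p ((0, 0), (1, 0))
          - fderiv ℝ (fun q => fderiv ℝ (LagOne μ) q ((1, 0), (0, 0))) p ((0, 0), (0, 1))
        = (1 - p.1.1 ^ 2 - p.1.2 ^ 2) ^ (-(3 : ℝ) / 2))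
      ∧ (fderiv ℝ (fun q => fderiv ℝ (LagTwo μ) q ((0, 1), (0, 0))) p ((0, 0), (1, 0))
          - fderiv ℝ (fun q => fderiv ℝ (LagTwo μ) q ((1, 0), (0, 0))) p ((0, 0), (0, 1))
        = (1 - p.1.1 ^ 2 - p.1.2 ^ 2) ^ (-(3 : ℝ) / 2)) := by
  intro p h h₂ h₁
  have hr : Real.sqrt (1 - p.1.1 ^ 2 - p.1.2 ^ 2) ≠ 0 := (Real.sqrt_pos.2 (by linarith)).ne'
  have hsqrt : ContDiffAt ℝ 2 (fun v : ℝ × ℝ => Real.sqrt (1 - v.1 ^ 2 - v.2 ^ 2)) p.1 :=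
    contDiffAt_sqrt_one_sub_sq_sub_sq h (n := 2)
  have hg : ContDiffAt ℝ 2 (fun v : ℝ × ℝ => μ * Real.sqrt (1 - v.1 ^ 2 - v.2 ^ 2)) p.1 :=
    contDiffAt_const.mul hsqrt
  constructor
  · have hf : ContDiffAt ℝ 2
        (fun v : ℝ × ℝ => -(v.1 / (Real.sqrt (1 - v.1 ^ 2 - v.2 ^ 2) * (1 - v.2 ^ 2)))) p.1 :=
      (contDiffAt_fst.div (hsqrt.mul (by fun_prop))
        (mul_ne_zero hr (by linarith))).neg
    have hL : LagOne μ = fun r => ContinuousLinearMap.snd ℝ ℝ ℝ r.2 *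
        -(r.1.1 / (Real.sqrt (1 - r.1.1 ^ 2 - r.1.2 ^ 2) * (1 - r.1.2 ^ 2)))
          + μ * Real.sqrt (1 - r.1.1 ^ 2 - r.1.2 ^ 2) := by
      funext r
      simp only [LagOne, ContinuousLinearMap.coe_snd']
      ring
    have hpart := (hf.differentiableAt (by simp)).hasFDerivAt.comp_hasDerivAt p.1.1
      ((hasDerivAt_id p.1.1).prodMk (hasDerivAt_const p.1.1 p.1.2))
    have key := hpart.unique (hasDerivAt_div_sqrt_one_sub_sq_sub_sq h).neg
    have e₁ := fderiv_fderiv_affine_snd (ContinuousLinearMap.snd ℝ ℝ ℝ) hf hg (0, 1) (1, 0)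
    have e₂ := fderiv_fderiv_affine_snd (ContinuousLinearMap.snd ℝ ℝ ℝ) hf hg (1, 0) (0, 1)
    rw [key] at e₂
    rw [hL]
    refine (congrArg₂ (· - ·) e₁ e₂).trans ?_
    simp
  · have hf : ContDiffAt ℝ 2
        (fun v : ℝ × ℝ => v.2 / (Real.sqrt (1 - v.1 ^ 2 - v.2 ^ 2) * (1 - v.1 ^ 2))) p.1 :=
      contDiffAt_snd.div (hsqrt.mul (by fun_prop))
        (mul_ne_zero hr (by linarith))
    have hL : LagTwo μ = fun r => ContinuousLinearMap.fst ℝ ℝ ℝ r.2 *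
        (r.1.2 / (Real.sqrt (1 - r.1.1 ^ 2 - r.1.2 ^ 2) * (1 - r.1.1 ^ 2)))
          + μ * Real.sqrt (1 - r.1.1 ^ 2 - r.1.2 ^ 2) := by
      funext r
      simp only [LagTwo, ContinuousLinearMap.coe_fst']
      ring
    have hpart := (hf.differentiableAt (by simp)).hasFDerivAt.comp_hasDerivAt p.1.2
      ((hasDerivAt_const p.1.2 p.1.1).prodMk (hasDerivAt_id p.1.2))
    have hder := hasDerivAt_div_sqrt_one_sub_sq_sub_sq (x := p.1.2) (y := p.1.1) (by linarith)
    simp only [sub_right_comm (1 : ℝ) _ (p.1.1 ^ 2)] at hder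
    have key := hpart.unique hder
    have e₁ := fderiv_fderiv_affine_snd (ContinuousLinearMap.fst ℝ ℝ ℝ) hf hg (0, 1) (1, 0)
    have e₂ := fderiv_fderiv_affine_snd (ContinuousLinearMap.fst ℝ ℝ ℝ) hf hg (1, 0) (0, 1)
    rw [key] at e₁
    rw [hL]
    refine (congrArg₂ (· - ·) e₁ e₂).trans ?_
    simp
end
end

section
/- Fix μ ∈ ℝ and define, on the set {(v, w) ∈ ℝ² × ℝ² : v₁² + v₂² < 1}, L₁(v, w) = − w₂ v₁ / ( √(1 − v₁² − v₂²) · (1 − v₂²) ) + μ √(1 − v₁² − v₂²) and L₂(v, w) = w₁ v₂ / ( √(1 − v₁² − v₂²) · (1 − v₁²) ) + μ √(1 − v₁² − v₂²). For an autonomous second-order Lagrange function L(v, w), define its Euler–Poisson expressions as the functions of (v, w, w′) given by E_i(L) = − D(∂L/∂v^i) + D²(∂L/∂w^i), where the total derivative D acts on functions of (v, w) as D = w·∂_v + w′·∂_w (and, on the resulting functions of (v, w, w′), additionally by w″·∂_{w′}; since L₁ and L₂ are affine in w, their Euler–Poisson expressions depend only on (v, w, w′)). Then E_i(L₁) = E_i(L₂)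 identically for i = 1, 2 on {v₁² + v₂² < 1} × ℝ² × ℝ². -/
noncomputable section

/-- Third-order jet of an autonomous planar problem: `((v, w), w′)`. -/
abbrev PJ3 : Type := ((ℝ × ℝ) × (ℝ × ℝ)) × (ℝ × ℝ)

/-- The total derivative `D = w·∂_v + w′·∂_w` acting on functions of `(v, w, w′)`
(truncated: for functions arising from Lagrangians affine in `w`, no `w″`-term is
needed). -/
def totD14 (F : PJ3 → ℝ) (p : PJ3) : ℝ :=
  p.1.2.1 * fderiv ℝ F p (((1, 0), (0, 0)), (0, 0))
    + p.1.2.2 * fderiv ℝ F p (((0, 1), (0, 0)), (0, 0))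
    + p.2.1 * fderiv ℝ F p (((0, 0), (1, 0)), (0, 0))
    + p.2.2 * fderiv ℝ F p (((0, 0), (0, 1)), (0, 0))

/-- Extension of a function of `(v, w)` to a function of `(v, w, w′)`. -/
def extVW (F : (ℝ × ℝ) × (ℝ × ℝ) → ℝ) : PJ3 → ℝ := fun p => F p.1

/-- The Euler–Poisson expression `E(L) = −D(∂L/∂v) + D²(∂L/∂w)` of an autonomous
second-order Lagrange function `L(v, w)`, in the direction `e` (`e = (1,0)` gives `E₁`,
`e = (0,1)` gives `E₂`), as a function of `(v, w, w′)`. -/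
def eulerPoisson14 (L : (ℝ × ℝ) × (ℝ × ℝ) → ℝ) (e : ℝ × ℝ) (p : PJ3) : ℝ :=
  - totD14 (extVW (fun q => fderiv ℝ L q (e, (0, 0)))) p
    + totD14 (totD14 (extVW (fun q => fderiv ℝ L q ((0, 0), e)))) p

open Filter Topology
open scoped ContDiff

/-- The total derivative is the derivative in the direction `(w, w′, 0)`. -/
theorem totD14_eq (F : PJ3 → ℝ) (p : PJ3) :
    totD14 F p = fderiv ℝ F p ((p.1.2, p.2), (0, 0)) := by
  have h : (((p.1.2, p.2), (0, 0)) : PJ3)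
      = p.1.2.1 • ((((1, 0), (0, 0)), (0, 0)) : PJ3) + p.1.2.2 • ((((0, 1), (0, 0)), (0, 0)) : PJ3)
        + p.2.1 • ((((0, 0), (1, 0)), (0, 0)) : PJ3)
        + p.2.2 • ((((0, 0), (0, 1)), (0, 0)) : PJ3) := by
    ext <;> simp
  rw [h]
  simp only [map_add, map_smul, smul_eq_mul, totD14]

theorem totD14_congr {F G : PJ3 → ℝ} {p : PJ3} (h : F =ᶠ[𝓝 p] G) :
    totD14 F =ᶠ[𝓝 p] totD14 G := by
  filter_upwards [h.fderiv (𝕜 := ℝ)] with q hq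
  simp only [totD14_eq, hq]

theorem totD14_add {F G : PJ3 → ℝ} {p : PJ3} (hF : ContDiffAt ℝ ω F p)
    (hG : ContDiffAt ℝ ω G p) :
    totD14 (fun q => F q + G q) =ᶠ[𝓝 p] fun q => totD14 F q + totD14 G q := by
  filter_upwards [hF.eventually (by simp), hG.eventually (by simp)] with q hFq hGq
  simp only [totD14_eq]
  rw [fderiv_fun_add (hFq.differentiableAt (by simp)) (hGq.differentiableAt (by simp))]
  rfl

theorem contDiffAt_totD14 {F : PJ3 → ℝ} {p : PJ3} (hF : ContDiffAt ℝ ω F p) :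
    ContDiffAt ℝ ω (totD14 F) p := by
  have h : totD14 F = fun q => fderiv ℝ F q ((q.1.2, q.2), (0, 0)) :=
    funext (totD14_eq F)
  rw [h]
  exact (hF.fderiv_right (m := ω) le_rfl).clm_apply (by fun_prop)

theorem contDiffAt_extVW {F : (ℝ × ℝ) × (ℝ × ℝ) → ℝ} {p : PJ3} (hF : ContDiffAt ℝ ω F p.1) :
    ContDiffAt ℝ ω (extVW F) p :=
  hF.comp p contDiffAt_fst

theorem extVW_congr {F G : (ℝ × ℝ) × (ℝ × ℝ) → ℝ} {p : PJ3} (h : F =ᶠ[𝓝 p.1] G) :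
    extVW F =ᶠ[𝓝 p] extVW G :=
  continuousAt_fst.eventually h

theorem eulerPoisson14_congr {L M : (ℝ × ℝ) × (ℝ × ℝ) → ℝ} {p : PJ3} (h : L =ᶠ[𝓝 p.1] M)
    (e : ℝ × ℝ) : eulerPoisson14 L e p = eulerPoisson14 M e p := by
  have key (u : (ℝ × ℝ) × (ℝ × ℝ)) :
      (fun q => fderiv ℝ L q u) =ᶠ[𝓝 p.1] fun q => fderiv ℝ M q u := by
    filter_upwards [h.fderiv (𝕜 := ℝ)] with q hq
    rw [hq]
  unfold eulerPoisson14
  rw [(totD14_congr (extVW_congr (key _))).eq_of_nhds,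
    (totD14_congr (totD14_congr (extVW_congr (key _)))).eq_of_nhds]

theorem eulerPoisson14_add {L M : (ℝ × ℝ) × (ℝ × ℝ) → ℝ} {p : PJ3}
    (hL : ContDiffAt ℝ ω L p.1) (hM : ContDiffAt ℝ ω M p.1) (e : ℝ × ℝ) :
    eulerPoisson14 (fun q => L q + M q) e p = eulerPoisson14 L e p + eulerPoisson14 M e p := by
  have smooth {N : (ℝ × ℝ) × (ℝ × ℝ) → ℝ} (hN : ContDiffAt ℝ ω N p.1)
      (u : (ℝ × ℝ) × (ℝ × ℝ)) : ContDiffAt ℝ ω (extVW fun q => fderiv ℝ N q u) p :=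
    contDiffAt_extVW ((hN.fderiv_right (m := ω) le_rfl).clm_apply contDiffAt_const)
  have key (u : (ℝ × ℝ) × (ℝ × ℝ)) :
      totD14 (extVW fun q => fderiv ℝ (fun q => L q + M q) q u) =ᶠ[𝓝 p]
        fun q => totD14 (extVW fun q => fderiv ℝ L q u) q
          + totD14 (extVW fun q => fderiv ℝ M q u) q := by
    refine (totD14_congr (extVW_congr
      (G := fun q => fderiv ℝ L q u + fderiv ℝ M q u) ?_)).trans (totD14_add (smooth hL u) (smooth hM u))
    filter_upwards [hL.eventually (by simp), hM.eventually (by simp)] with q hLq hMq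
    rw [fderiv_fun_add (hLq.differentiableAt (by simp)) (hMq.differentiableAt (by simp))]
    rfl
  unfold eulerPoisson14
  rw [(key _).eq_of_nhds, (totD14_congr (key _)).eq_of_nhds,
    (totD14_add (contDiffAt_totD14 (smooth hL _)) (contDiffAt_totD14 (smooth hM _))).eq_of_nhds]
  ring

/-- A total derivative `D f = w·∂_v f` has vanishing Euler–Poisson expressions. -/
theorem eulerPoisson14_totalDerivative {f : ℝ × ℝ → ℝ} {p : PJ3}
    (hf : ContDiffAt ℝ ω f p.1.1) (e : ℝ × ℝ) :
    eulerPoisson14 (fun q => fderiv ℝ f q.1 q.2) e p = 0 := by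
  have hev : ∀ᶠ q in 𝓝 p.1, ContDiffAt ℝ ω f q.1 :=
    continuousAt_fst.eventually (hf.eventually (by simp))
  have hder (q : (ℝ × ℝ) × (ℝ × ℝ)) (hq : ContDiffAt ℝ ω f q.1) (a b : ℝ × ℝ) :
      fderiv ℝ (fun q : (ℝ × ℝ) × (ℝ × ℝ) => fderiv ℝ f q.1 q.2) q (a, b)
        = fderiv ℝ (fderiv ℝ f) q.1 a q.2 + fderiv ℝ f q.1 b := by
    have h1 : HasFDerivAt (fderiv ℝ f) (fderiv ℝ (fderiv ℝ f) q.1) q.1 :=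
      ((hq.fderiv_right (m := ω) le_rfl).differentiableAt (by simp)).hasFDerivAt
    have h2 := (h1.comp q hasFDerivAt_fst).clm_apply (hasFDerivAt_snd (𝕜 := ℝ) (p := q))
    rw [show (fun q : (ℝ × ℝ) × (ℝ × ℝ) => fderiv ℝ f q.1 q.2)
      = fun q => (fderiv ℝ f ∘ Prod.fst) q q.2 from rfl, h2.fderiv]
    simp [add_comm]
  have hw : totD14 (extVW fun q => fderiv ℝ (fun q : (ℝ × ℝ) × (ℝ × ℝ) => fderiv ℝ f q.1 q.2) q
        ((0, 0), e)) =ᶠ[𝓝 p]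
      extVW fun q => fderiv ℝ (fun q : (ℝ × ℝ) × (ℝ × ℝ) => fderiv ℝ f q.1 q.2) q (e, (0, 0)) := by
    have h0 : (extVW fun q => fderiv ℝ (fun q : (ℝ × ℝ) × (ℝ × ℝ) => fderiv ℝ f q.1 q.2) q
        ((0, 0), e)) =ᶠ[𝓝 p] fun q => fderiv ℝ f q.1.1 e := by
      refine extVW_congr (G := fun q => fderiv ℝ f q.1 e) ?_
      filter_upwards [hev] with q hq
      rw [hder q hq, ← Prod.zero_eq_mk]
      simp
    refine (totD14_congr h0).trans ?_
    filter_upwards [continuousAt_fst.eventually hev] with q hq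
    have h1 : HasFDerivAt (fderiv ℝ f) (fderiv ℝ (fderiv ℝ f) q.1.1) q.1.1 :=
      ((hq.fderiv_right (m := ω) le_rfl).differentiableAt (by simp)).hasFDerivAt
    have h2 := (h1.comp q (hasFDerivAt_fst.comp q hasFDerivAt_fst)).clm_apply
      (hasFDerivAt_const e q)
    have hsymm : IsSymmSndFDerivAt ℝ f q.1.1 := hq.isSymmSndFDerivAt (by simp)
    rw [totD14_eq, extVW, hder q.1 hq, ← Prod.zero_eq_mk, map_zero, add_zero, hsymm.eq]
    rw [show (fun q : PJ3 => fderiv ℝ f q.1.1 e)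
      = fun q => (fderiv ℝ f ∘ (Prod.fst ∘ Prod.fst)) q e from rfl, h2.fderiv]
    simp
  unfold eulerPoisson14
  rw [(totD14_congr hw).eq_of_nhds]
  ring

/-- The potential whose total derivative is `L₁ − L₂`. -/
def lagPotential (v : ℝ × ℝ) : ℝ :=
  -Real.arctan (v.1 * v.2 / Real.sqrt (1 - v.1 ^ 2 - v.2 ^ 2))

theorem contDiffAt_lagPotential {v : ℝ × ℝ} (hv : v.1 ^ 2 + v.2 ^ 2 < 1) :
    ContDiffAt ℝ ω lagPotential v := by
  have h : 1 - v.1 ^ 2 - v.2 ^ 2 ≠ 0 := by linarith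
  have hs : Real.sqrt (1 - v.1 ^ 2 - v.2 ^ 2) ≠ 0 :=
    Real.sqrt_ne_zero'.2 (by linarith)
  unfold lagPotential
  have hq : ContDiffAt ℝ ω
      (fun v : ℝ × ℝ => v.1 * v.2 / Real.sqrt (1 - v.1 ^ 2 - v.2 ^ 2)) v :=
    ContDiffAt.div (by fun_prop) (ContDiffAt.sqrt (by fun_prop) h) hs
  exact (Real.contDiff_arctan.contDiffAt.comp v hq).neg

theorem contDiffAt_lagTwo (μ : ℝ) {q : (ℝ × ℝ) × (ℝ × ℝ)} (hq : q.1.1 ^ 2 + q.1.2 ^ 2 < 1) :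
    ContDiffAt ℝ ω (LagTwo μ) q := by
  have h : 1 - q.1.1 ^ 2 - q.1.2 ^ 2 ≠ 0 := by linarith
  have hs : Real.sqrt (1 - q.1.1 ^ 2 - q.1.2 ^ 2) ≠ 0 :=
    Real.sqrt_ne_zero'.2 (by linarith)
  have h1 : 1 - q.1.1 ^ 2 ≠ 0 := by nlinarith [sq_nonneg q.1.2]
  have hsm : ContDiffAt ℝ ω
      (fun q : (ℝ × ℝ) × (ℝ × ℝ) => Real.sqrt (1 - q.1.1 ^ 2 - q.1.2 ^ 2)) q :=
    ContDiffAt.sqrt (by fun_prop) h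
  unfold LagTwo
  exact (ContDiffAt.div (by fun_prop) (hsm.mul (by fun_prop)) (mul_ne_zero hs h1)).add
    (contDiffAt_const.mul hsm)

theorem lagOne_eq (μ : ℝ) {q : (ℝ × ℝ) × (ℝ × ℝ)} (hq : q.1.1 ^ 2 + q.1.2 ^ 2 < 1) :
    LagOne μ q = LagTwo μ q + fderiv ℝ lagPotential q.1 q.2 := by
  obtain ⟨⟨x, y⟩, ⟨a, b⟩⟩ := q
  simp only at hq
  have hpos : 0 < 1 - x ^ 2 - y ^ 2 := by linarith
  have hx : 1 - x ^ 2 ≠ 0 := by nlinarith [sq_nonneg y]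
  have hy : 1 - y ^ 2 ≠ 0 := by nlinarith [sq_nonneg x]
  have hs : Real.sqrt (1 - x ^ 2 - y ^ 2) ≠ 0 := Real.sqrt_ne_zero'.2 hpos
  have hs2 : Real.sqrt (1 - x ^ 2 - y ^ 2) ^ 2 = 1 - x ^ 2 - y ^ 2 := Real.sq_sqrt hpos.le
  have hfst : HasFDerivAt (fun v : ℝ × ℝ => v.1) (ContinuousLinearMap.fst ℝ ℝ ℝ) (x, y) :=
    hasFDerivAt_fst
  have hsnd : HasFDerivAt (fun v : ℝ × ℝ => v.2) (ContinuousLinearMap.snd ℝ ℝ ℝ) (x, y) :=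
    hasFDerivAt_snd
  have hsq := (((hfst.pow 2).const_sub 1).fun_sub (hsnd.pow 2)).sqrt hpos.ne'
  have hder : HasFDerivAt lagPotential _ (x, y) := ((hfst.fun_mul hsnd).fun_mul
    ((hasDerivAt_inv hs).comp_hasFDerivAt (x, y) hsq)).arctan.neg
  rw [hder.fderiv]
  simp only [LagOne, LagTwo, nsmul_eq_mul, Function.comp_apply, one_div, neg_smul, smul_neg,
    add_apply, sub_apply, neg_apply, smul_apply,
    ContinuousLinearMap.coe_fst', ContinuousLinearMap.coe_snd', smul_eq_mul]
  generalize Real.sqrt (1 - x ^ 2 - y ^ 2) = s at hs hs2 ⊢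
  have hinv : (1 + (x * y * s⁻¹) ^ 2)⁻¹ = s ^ 2 / ((1 - x ^ 2) * (1 - y ^ 2)) := by
    rw [inv_eq_iff_eq_inv, inv_div]
    field_simp
    linear_combination hs2
  rw [hinv]
  field_simp
  linear_combination 2 * (y * a + x * b) * hs2

/-- The two Lagrangians `L₁`, `L₂` have identical Euler–Poisson
expressions on `{v₁² + v₂² < 1} × ℝ² × ℝ²`. -/
theorem statement_14 (μ : ℝ) :
    ∀ p : PJ3, p.1.1.1 ^ 2 + p.1.1.2 ^ 2 < 1 →
      eulerPoisson14 (LagOne μ) (1, 0) p = eulerPoisson14 (LagTwo μ) (1, 0) p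
      ∧ eulerPoisson14 (LagOne μ) (0, 1) p = eulerPoisson14 (LagTwo μ) (0, 1) p := by
  intro p hp
  have hev : LagOne μ =ᶠ[𝓝 p.1] fun q => LagTwo μ q + fderiv ℝ lagPotential q.1 q.2 := by
    have hcont : Continuous fun q : (ℝ × ℝ) × (ℝ × ℝ) => q.1.1 ^ 2 + q.1.2 ^ 2 := by fun_prop
    filter_upwards [hcont.continuousAt.eventually_lt continuousAt_const hp] with q hq
    exact lagOne_eq μ hq
  have hpot := contDiffAt_lagPotential hp
  have hD : ContDiffAt ℝ ω
      (fun q : (ℝ × ℝ) × (ℝ × ℝ) => fderiv ℝ lagPotential q.1 q.2) p.1 :=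
    ((hpot.fderiv_right (m := ω) le_rfl).comp p.1 contDiffAt_fst).clm_apply contDiffAt_snd
  have key (e : ℝ × ℝ) : eulerPoisson14 (LagOne μ) e p = eulerPoisson14 (LagTwo μ) e p := by
    rw [eulerPoisson14_congr hev, eulerPoisson14_add (contDiffAt_lagTwo μ hp) hD,
      eulerPoisson14_totalDerivative hpot, add_zero]
  exact ⟨key _, key _⟩
end
end

section
/- On the open unit disc D = {v ∈ ℝ² : v₁² + v₂² < 1} there exists a smooth function F: D → ℝ such that ∂F/∂v₁ = − v₂ / ( √(1 − v₁² − v₂²) · (1 − v₁²) ) and ∂F/∂v₂ = − v₁ / ( √(1 − v₁² − v₂²) · (1 − v₂²) ). Consequently, the difference L₁ − L₂ of the two Lagrange functions L₁(v,w) = − w₂ v₁/(√(1 − v₁² − v₂²)(1 − v₂²)) + μ√(1 − v₁² − v₂²) and L₂(v,w) = w₁ v₂/(√(1 − v₁² − v₂²)(1 − v₁²)) + μ√(1 − v₁² − v₂²) equals the total derivative w₁ ∂F/∂v₁ + w₂ ∂F/∂v₂, i.e. L₁ − L₂ is a null Lagrangian on D. -/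
noncomputable section

/-- `-arctan (v₁ v₂ / √(1 - v₁² - v₂²))`, a potential on the open unit disc. -/
def discPotential (v : ℝ × ℝ) : ℝ :=
  -Real.arctan (v.1 * v.2 / Real.sqrt (1 - v.1 ^ 2 - v.2 ^ 2))

theorem contDiffOn_discPotential {n : ℕ∞} :
    ContDiffOn ℝ n discPotential {v : ℝ × ℝ | v.1 ^ 2 + v.2 ^ 2 < 1} := by
  intro v hv
  have hpos : 0 < 1 - v.1 ^ 2 - v.2 ^ 2 := by
    have : v.1 ^ 2 + v.2 ^ 2 < 1 := hv
    linarith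
  have hg : ContDiffAt ℝ n (fun v : ℝ × ℝ => 1 - v.1 ^ 2 - v.2 ^ 2) v := by fun_prop
  have hnum : ContDiffAt ℝ n (fun v : ℝ × ℝ => v.1 * v.2) v := by fun_prop
  exact (hnum.div (hg.sqrt hpos.ne') (Real.sqrt_pos.2 hpos).ne').arctan.neg.contDiffWithinAt

theorem hasFDerivAt_discPotential {v : ℝ × ℝ} (hv : v.1 ^ 2 + v.2 ^ 2 < 1) :
    HasFDerivAt discPotential
      ((-v.2 / (Real.sqrt (1 - v.1 ^ 2 - v.2 ^ 2) * (1 - v.1 ^ 2))) •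
          ContinuousLinearMap.fst ℝ ℝ ℝ
        + (-v.1 / (Real.sqrt (1 - v.1 ^ 2 - v.2 ^ 2) * (1 - v.2 ^ 2))) •
          ContinuousLinearMap.snd ℝ ℝ ℝ) v := by
  have hpos : 0 < 1 - v.1 ^ 2 - v.2 ^ 2 := by linarith
  have hx : 1 - v.1 ^ 2 ≠ 0 := by nlinarith [sq_nonneg v.2]
  have hy : 1 - v.2 ^ 2 ≠ 0 := by nlinarith [sq_nonneg v.1]
  have h1 : HasFDerivAt (fun v : ℝ × ℝ => v.1) (ContinuousLinearMap.fst ℝ ℝ ℝ) v :=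
    hasFDerivAt_fst
  have h2 : HasFDerivAt (fun v : ℝ × ℝ => v.2) (ContinuousLinearMap.snd ℝ ℝ ℝ) v :=
    hasFDerivAt_snd
  have hs := (((h1.pow 2).const_sub 1).sub (h2.pow 2)).sqrt hpos.ne'
  have hinv := (hasDerivAt_inv (Real.sqrt_pos.2 hpos).ne').comp_hasFDerivAt v hs
  refine ((h1.mul h2).mul hinv).arctan.neg.congr_fderiv ?_
  have hsq := Real.sq_sqrt hpos.le
  have hspos := Real.sqrt_pos.2 hpos
  have hden : 1 + (v.1 * v.2 * (Real.sqrt (1 - v.1 ^ 2 - v.2 ^ 2))⁻¹) ^ 2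
      = (1 - v.1 ^ 2) * (1 - v.2 ^ 2) / Real.sqrt (1 - v.1 ^ 2 - v.2 ^ 2) ^ 2 := by
    field_simp
    rw [hsq]
    ring
  ext
  all_goals
    simp [hden]
    set s := Real.sqrt (1 - v.1 ^ 2 - v.2 ^ 2)
    field_simp
    rw [hsq]
    ring

/-- On the open unit disc there is a smooth function `F(v)` with
`∂F/∂v₁ = −v₂/(√(1−v₁²−v₂²)(1−v₁²))` and `∂F/∂v₂ = −v₁/(√(1−v₁²−v₂²)(1−v₂²))`;
consequently `L₁ − L₂ = w·∇F` is a null Lagrangian on the disc. -/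
theorem statement_15 (μ : ℝ) :
    ∃ F : ℝ × ℝ → ℝ,
      ContDiffOn ℝ (⊤ : ℕ∞) F {v : ℝ × ℝ | v.1 ^ 2 + v.2 ^ 2 < 1} ∧
      (∀ v : ℝ × ℝ, v.1 ^ 2 + v.2 ^ 2 < 1 →
        fderiv ℝ F v (1, 0)
            = -v.2 / (Real.sqrt (1 - v.1 ^ 2 - v.2 ^ 2) * (1 - v.1 ^ 2))
          ∧ fderiv ℝ F v (0, 1)
            = -v.1 / (Real.sqrt (1 - v.1 ^ 2 - v.2 ^ 2) * (1 - v.2 ^ 2))) ∧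
      (∀ v : ℝ × ℝ, v.1 ^ 2 + v.2 ^ 2 < 1 → ∀ w : ℝ × ℝ,
        LagOne μ (v, w) - LagTwo μ (v, w)
          = w.1 * fderiv ℝ F v (1, 0) + w.2 * fderiv ℝ F v (0, 1)) := by
  refine ⟨discPotential, contDiffOn_discPotential, fun v hv => ?_, fun v hv w => ?_⟩
  · rw [(hasFDerivAt_discPotential hv).fderiv]
    simp
  · rw [(hasFDerivAt_discPotential hv).fderiv]
    simp [LagOne, LagTwo]
    ring
end
end
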